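/- Assume |ξ(x)|³ ≤ c V(x) for all x ∈ E and some constant c > 0, σ² > 0, and 𝔼[V(X_0)] < ∞. Then there exists C > 0 such that for all n ≥ 1: sup_{x∈ℝ} |ℙ(S_n/(σ√n) ≤ x) − Φ(x)| ≤ C n^{−1/2}, where Φ is the standard normal cumulative distribution function. -/

import Mathlib

open MeasureTheory ProbabilityTheory Filter

/-! ### Esseen's smoothing inequality -/

/-- The (unnormalized) Fejér kernel `(1 - cos v) / v ^ 2`, written as a Fourier integral. -/
noncomputable def fejerKernel (v : ℝ) : ℝ := ∫ s in (0 : ℝ)..1, (1 - s) * Real.cos (s * v)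

lemma fejerKernel_zero : fejerKernel 0 = 1 / 2 := by
  simp only [fejerKernel, mul_zero, Real.cos_zero, mul_one]
  rw [intervalIntegral.integral_sub (by simp) (by simp)]
  norm_num [integral_id]

lemma fejerKernel_of_ne_zero {v : ℝ} (hv : v ≠ 0) :
    fejerKernel v = (1 - Real.cos v) / v ^ 2 := by
  have hderiv : ∀ s ∈ Set.uIcc (0 : ℝ) 1, HasDerivAt
      (fun s : ℝ => (1 - s) * (Real.sin (s * v) / v) - Real.cos (s * v) / v ^ 2)
      ((1 - s) * Real.cos (s * v)) s := by
    intro s _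
    have h1 : HasDerivAt (fun s : ℝ => s * v) v s := by
      simpa using (hasDerivAt_id s).mul_const v
    have h2 : HasDerivAt (fun s : ℝ => 1 - s) (-1) s := by
      simpa using (hasDerivAt_id s).const_sub 1
    refine ((h2.mul (h1.sin.div_const v)).sub (h1.cos.div_const (v ^ 2))).congr_deriv ?_
    field_simp
    ring
  rw [fejerKernel, intervalIntegral.integral_eq_sub_of_hasDerivAt hderiv
    (Continuous.intervalIntegrable (by fun_prop) _ _)]
  simp
  field_simp
  ring

lemma fejerKernel_nonneg (v : ℝ) : 0 ≤ fejerKernel v := by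
  rcases eq_or_ne v 0 with rfl | hv
  · rw [fejerKernel_zero]; norm_num
  · rw [fejerKernel_of_ne_zero hv]
    exact div_nonneg (by linarith [Real.cos_le_one v]) (sq_nonneg v)

lemma fejerKernel_le (v : ℝ) : fejerKernel v ≤ 3 * (1 + v ^ 2)⁻¹ := by
  rcases eq_or_ne v 0 with rfl | hv
  · rw [fejerKernel_zero]; norm_num
  · have hv2 : 0 < v ^ 2 := by positivity
    rw [fejerKernel_of_ne_zero hv, ← div_eq_mul_inv, div_le_div_iff₀ hv2 (by positivity)]
    nlinarith [Real.neg_one_le_cos v, Real.one_sub_sq_div_two_le_cos (x := v)]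

lemma continuous_fejerKernel : Continuous fejerKernel :=
  intervalIntegral.continuous_parametric_intervalIntegral_of_continuous' (by fun_prop) 0 1

lemma integrable_fejerKernel : Integrable fejerKernel := by
  refine (integrable_inv_one_add_sq.const_mul 3).mono'
    continuous_fejerKernel.aestronglyMeasurable (ae_of_all _ fun v => ?_)
  rw [Real.norm_of_nonneg (fejerKernel_nonneg v)]
  exact fejerKernel_le v

lemma integral_fejerKernel_pos : 0 < ∫ v, fejerKernel v := by
  rw [integral_pos_iff_support_of_nonneg fejerKernel_nonneg integrable_fejerKernel]
  refine continuous_fejerKernel.isOpen_support.measure_pos _ ⟨0, ?_⟩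
  simp [fejerKernel_zero]

lemma integrable_fejerKernel_sub (μ : Measure ℝ) [IsFiniteMeasure μ] :
    Integrable (fun p : ℝ × ℝ => fejerKernel (p.1 - p.2)) (volume.prod μ) := by
  have hc := continuous_fejerKernel
  rw [integrable_prod_iff' (Continuous.aestronglyMeasurable (by fun_prop))]
  refine ⟨ae_of_all _ fun y => integrable_fejerKernel.comp_sub_right y, ?_⟩
  have : ∀ y : ℝ, ∫ x, ‖fejerKernel (x - y)‖ = ∫ x, ‖fejerKernel x‖ := fun y =>
    integral_sub_right_eq_self (fun x => ‖fejerKernel x‖) y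
  simp only [this]
  exact integrable_const _

/-- Convolution with the Fejér kernel, integrated over a half-line. -/
lemma integral_Iic_fejerKernel (μ : Measure ℝ) [IsFiniteMeasure μ] (b : ℝ) :
    ∫ u in Set.Iic b, ∫ y, fejerKernel (u - y) ∂μ
      = ∫ v, μ.real (Set.Iic (b - v)) * fejerKernel v := by
  have hc := continuous_fejerKernel
  have hswap : ∀ v y : ℝ, (Set.Iic b).indicator (fun u => fejerKernel (u - y)) (v + y)
      = (Set.Iic (b - v)).indicator (fun _ => fejerKernel v) y := by
    intro v y
    by_cases h : v + y ≤ b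
    · rw [Set.indicator_of_mem (by exact h), Set.indicator_of_mem (by simp; linarith)]
      simp
    · rw [Set.indicator_of_notMem (by exact h), Set.indicator_of_notMem (by simp; linarith)]
  have hint : Integrable (fun p : ℝ × ℝ =>
      (Set.Iic b).indicator (fun u => fejerKernel (u - p.2)) p.1) (volume.prod μ) := by
    have := (integrable_fejerKernel_sub μ).indicator
      (measurableSet_Iic.preimage measurable_fst : MeasurableSet (Prod.fst ⁻¹' Set.Iic b))
    refine this.congr (ae_of_all _ fun p => ?_)
    simp [Set.indicator]
  have hint2 : Integrable (fun p : ℝ × ℝ =>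
      (Set.Iic (b - p.1)).indicator (fun _ => fejerKernel p.1) p.2) (volume.prod μ) := by
    have h1 : Integrable (fun p : ℝ × ℝ => fejerKernel p.1) (volume.prod μ) := by
      simpa using integrable_fejerKernel.mul_prod (integrable_const (μ := μ) (1 : ℝ))
    have hs : MeasurableSet {p : ℝ × ℝ | p.2 ≤ b - p.1} :=
      measurableSet_le measurable_snd (by fun_prop)
    refine (h1.indicator hs).congr (ae_of_all _ fun p => ?_)
    simp [Set.indicator]
  calc ∫ u in Set.Iic b, ∫ y, fejerKernel (u - y) ∂μ
      = ∫ u, ∫ y, (Set.Iic b).indicator (fun u => fejerKernel (u - y)) u ∂μ := by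
        rw [← integral_indicator measurableSet_Iic]
        congr 1 with u
        by_cases h : u ≤ b <;> simp [Set.indicator, h]
    _ = ∫ y, ∫ u, (Set.Iic b).indicator (fun u => fejerKernel (u - y)) u ∂volume ∂μ :=
        integral_integral_swap hint
    _ = ∫ y, ∫ v, (Set.Iic (b - v)).indicator (fun _ => fejerKernel v) y ∂volume ∂μ := by
        congr 1 with y
        rw [← integral_add_right_eq_self _ y]
        simp only [hswap]
    _ = ∫ v, ∫ y, (Set.Iic (b - v)).indicator (fun _ => fejerKernel v) y ∂μ ∂volume :=
        (integral_integral_swap hint2).symm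
    _ = _ := by
        congr 1 with v
        rw [integral_indicator_const _ measurableSet_Iic, smul_eq_mul]

lemma integral_fejerKernel_sub_eq (μ : Measure ℝ) [IsFiniteMeasure μ] (u : ℝ) :
    ∫ y, fejerKernel (u - y) ∂μ = ∫ s in (0 : ℝ)..1,
      (1 - s) * (Complex.exp (-(s * Complex.I) * u) * charFun μ s).re := by
  have hint : Integrable (Function.uncurry fun s y : ℝ => (1 - s) * Real.cos (s * (u - y)))
      ((volume.restrict (Set.uIoc 0 1)).prod μ) := by
    have hm : AEStronglyMeasurable
        (Function.uncurry fun s y : ℝ => (1 - s) * Real.cos (s * (u - y)))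
        ((volume.restrict (Set.uIoc 0 1)).prod μ) :=
      Continuous.aestronglyMeasurable (by fun_prop)
    have h1 : Integrable (fun p : ℝ × ℝ => (1 - p.1))
        ((volume.restrict (Set.uIoc (0 : ℝ) 1)).prod μ) := by
      have : Integrable (fun s : ℝ => 1 - s) (volume.restrict (Set.uIoc (0 : ℝ) 1)) :=
        (intervalIntegrable_iff.mp (Continuous.intervalIntegrable (by fun_prop) 0 1))
      simpa using this.mul_prod (integrable_const (μ := μ) (1 : ℝ))
    refine h1.mono hm (ae_of_all _ fun p => ?_)
    simp only [Function.uncurry, norm_mul]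
    exact mul_le_of_le_one_right (norm_nonneg _) (Real.abs_cos_le_one _)
  simp only [fejerKernel]
  rw [← intervalIntegral_integral_swap hint]
  congr 1 with s
  rw [integral_const_mul]
  congr 1
  rw [charFun_apply_real, ← integral_const_mul]
  have hi : Integrable (fun y : ℝ => Complex.exp (-(s * Complex.I) * u) *
      Complex.exp (s * y * Complex.I)) μ := by
    refine Integrable.of_bound (C := 1) (Continuous.aestronglyMeasurable (by fun_prop))
      (ae_of_all _ fun y => ?_)
    rw [← Complex.exp_add, Complex.norm_exp]
    simp
  have := integral_re hi
  simp only [RCLike.re_to_complex] at this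
  rw [← this]
  congr 1 with y
  rw [← Complex.exp_add, Complex.exp_re]
  simp
  rw [← Real.cos_neg]
  congr 1
  ring

lemma norm_integral_exp_le {s : ℝ} (hs : 0 < s) (a b : ℝ) :
    ‖∫ u in a..b, Complex.exp (-(s * Complex.I) * u)‖ ≤ 2 / s := by
  have hc : -((s : ℂ) * Complex.I) ≠ 0 := by
    simp [hs.ne']
  rw [integral_exp_mul_complex hc, norm_div]
  have h1 : ∀ u : ℝ, ‖Complex.exp (-(s * Complex.I) * u)‖ = 1 := fun u => by
    rw [Complex.norm_exp]; simp
  have h2 : ‖-((s : ℂ) * Complex.I)‖ = s := by simp [abs_of_pos hs]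
  rw [h2]
  gcongr
  refine (norm_sub_le _ _).trans ?_
  rw [h1, h1]
  norm_num

lemma abs_integral_smoothed_le {μ γ : Measure ℝ} [IsProbabilityMeasure μ]
    [IsProbabilityMeasure γ] {ψ : ℝ → ℝ} (hψi : IntervalIntegrable ψ volume 0 1)
    (h : ∀ s ∈ Set.Ioc (0 : ℝ) 1, ‖charFun μ s - charFun γ s‖ ≤ s * ψ s) (b : ℝ) :
    |∫ v, (μ.real (Set.Iic (b - v)) - γ.real (Set.Iic (b - v))) * fejerKernel v|
      ≤ 2 * ∫ s in (0 : ℝ)..1, ψ s := by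
  have hfin : ∀ a b : ℝ, IsFiniteMeasure ((volume : Measure ℝ).restrict (Set.uIoc a b)) :=
    fun a b => inferInstanceAs (IsFiniteMeasure (volume.restrict (Set.Ioc _ _)))
  have hint : ∀ (μ : Measure ℝ) [IsProbabilityMeasure μ],
      Integrable (fun u => ∫ y, fejerKernel (u - y) ∂μ) := fun μ _ =>
    (integrable_fejerKernel_sub μ).integral_prod_left
  have hintF : ∀ (μ : Measure ℝ) [IsProbabilityMeasure μ],
      Integrable (fun v => μ.real (Set.Iic (b - v)) * fejerKernel v) := by
    intro μ _
    have hanti : Antitone fun v : ℝ => μ.real (Set.Iic (b - v)) := fun v w hvw =>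
      measureReal_mono (Set.Iic_subset_Iic.mpr (by linarith))
    refine integrable_fejerKernel.bdd_mul (c := 1) hanti.measurable.aestronglyMeasurable
      (ae_of_all _ fun v => ?_)
    rw [Real.norm_of_nonneg measureReal_nonneg]
    exact measureReal_le_one
  set q : ℝ → ℝ := fun u => (∫ y, fejerKernel (u - y) ∂μ) - ∫ y, fejerKernel (u - y) ∂γ with hq
  have hqi : Integrable q := (hint μ).sub (hint γ)
  have hlim : ∫ v, (μ.real (Set.Iic (b - v)) - γ.real (Set.Iic (b - v))) * fejerKernel v
      = ∫ u in Set.Iic b, q u := by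
    simp only [sub_mul]
    rw [integral_sub (hintF μ) (hintF γ), ← integral_Iic_fejerKernel, ← integral_Iic_fejerKernel,
      ← integral_sub (hint μ).integrableOn (hint γ).integrableOn]
  rw [hlim]
  have htend := intervalIntegral_tendsto_integral_Iic b hqi.integrableOn
    (tendsto_id (α := ℝ))
  simp only [id_eq] at htend
  refine le_of_tendsto htend.abs (Filter.eventually_atBot.mpr ⟨b, fun a hab => ?_⟩)
  have hψ0 : ∀ s ∈ Set.Ioc (0 : ℝ) 1, 0 ≤ ψ s := fun s hs =>
    nonneg_of_mul_nonneg_right ((norm_nonneg _).trans (h s hs)) hs.1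
  have hphi : ∀ (μ : Measure ℝ) [IsProbabilityMeasure μ] (u : ℝ), IntervalIntegrable (fun s : ℝ =>
      (1 - s) * (Complex.exp (-(s * Complex.I) * u) * charFun μ s).re) volume 0 1 := by
    intro μ _ u
    rw [intervalIntegrable_iff]
    have hm := measurable_charFun (μ := μ)
    refine Integrable.of_bound (C := 1) (Measurable.aestronglyMeasurable (by fun_prop)) ?_
    rw [ae_restrict_iff' measurableSet_uIoc]
    refine ae_of_all _ fun s hs => ?_
    rw [Set.uIoc_of_le zero_le_one] at hs
    rw [norm_mul]
    refine mul_le_one₀ ?_ (norm_nonneg _) ?_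
    · rw [Real.norm_eq_abs, abs_le]; constructor <;> linarith [hs.1, hs.2]
    · refine (Complex.abs_re_le_norm _).trans ?_
      rw [norm_mul, Complex.norm_exp]
      simpa using norm_charFun_le_one (μ := μ) s
  set Δ : ℝ → ℂ := fun s => charFun μ s - charFun γ s with hΔ
  have hq2 : ∀ u, q u = ∫ s in (0 : ℝ)..1,
      (1 - s) * (Complex.exp (-(s * Complex.I) * u) * Δ s).re := by
    intro u
    rw [hq]
    simp only [integral_fejerKernel_sub_eq]
    rw [← intervalIntegral.integral_sub (hphi μ u) (hphi γ u)]
    congr 1 with s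
    rw [hΔ]
    simp only [mul_sub, Complex.sub_re]
  have hmΔ : Measurable Δ := by
    have := measurable_charFun (μ := μ)
    have := measurable_charFun (μ := γ)
    fun_prop
  have hΔ2 : ∀ s, ‖Δ s‖ ≤ 2 := fun s => by
    refine (norm_sub_le _ _).trans ?_
    linarith [norm_charFun_le_one (μ := μ) s, norm_charFun_le_one (μ := γ) s]
  have hprod : Integrable (Function.uncurry fun u s : ℝ =>
      (1 - s) * (Complex.exp (-(s * Complex.I) * u) * Δ s).re)
      ((volume.restrict (Set.uIoc a b)).prod (volume.restrict (Set.Ioc (0:ℝ) 1))) := by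
    refine Integrable.of_bound (C := 2) (Measurable.aestronglyMeasurable (by
      unfold Function.uncurry; fun_prop)) ?_
    rw [Measure.prod_restrict, ae_restrict_iff' (measurableSet_uIoc.prod measurableSet_Ioc)]
    refine ae_of_all _ fun p hp => ?_
    obtain ⟨-, hs⟩ := hp
    simp only [Function.uncurry]
    rw [norm_mul]
    have h1 : ‖1 - p.2‖ ≤ 1 := by
      rw [Real.norm_eq_abs, abs_le]; constructor <;> linarith [hs.1, hs.2]
    have h2 : ‖(Complex.exp (-(p.2 * Complex.I) * p.1) * Δ p.2).re‖ ≤ 2 := by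
      refine (Complex.abs_re_le_norm _).trans ?_
      rw [norm_mul, Complex.norm_exp]
      simpa using hΔ2 p.2
    exact (mul_le_mul h1 h2 (norm_nonneg _) zero_le_one).trans_eq (one_mul 2)
  have hkey : ∫ u in a..b, q u = ∫ s in (0 : ℝ)..1,
      (1 - s) * ((∫ u in a..b, Complex.exp (-(s * Complex.I) * u)) * Δ s).re := by
    simp only [hq2]
    simp only [intervalIntegral.integral_of_le zero_le_one]
    rw [intervalIntegral_integral_swap hprod]
    congr 1 with s
    rw [intervalIntegral.integral_const_mul, ← intervalIntegral.integral_mul_const]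
    congr 1
    have hi : IntervalIntegrable (fun u : ℝ => Complex.exp (-(s * Complex.I) * u) * Δ s)
        volume a b := Continuous.intervalIntegrable (by fun_prop) _ _
    have := Complex.reCLM.intervalIntegral_comp_comm hi
    simpa using this
  rw [hkey, ← Real.norm_eq_abs, ← intervalIntegral.integral_const_mul]
  refine intervalIntegral.norm_integral_le_of_norm_le zero_le_one (ae_of_all _ fun s hs => ?_)
    (hψi.const_mul 2)
  rw [norm_mul]
  have h1 : ‖1 - s‖ ≤ 1 := by
    rw [Real.norm_eq_abs, abs_le]; constructor <;> linarith [hs.1, hs.2]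
  have h2 : ‖((∫ u in a..b, Complex.exp (-(s * Complex.I) * u)) * Δ s).re‖ ≤ 2 * ψ s := by
    refine (Complex.abs_re_le_norm _).trans ?_
    rw [norm_mul]
    calc _ ≤ 2 / s * (s * ψ s) := by
          exact mul_le_mul (norm_integral_exp_le hs.1 a b) (h s hs) (norm_nonneg _)
            (div_nonneg zero_le_two hs.1.le)
      _ = 2 * ψ s := by
        have := hs.1.ne'
        field_simp
  calc _ ≤ 1 * (2 * ψ s) := by gcongr
    _ = _ := one_mul _

lemma exists_fejerKernel_window : ∃ a : ℝ, 0 < a ∧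
    3 / 4 * ∫ v, fejerKernel v ≤ ∫ v in Set.Ioc (-a) a, fejerKernel v := by
  have h := intervalIntegral_tendsto_integral integrable_fejerKernel
    tendsto_neg_atTop_atBot (tendsto_id (α := ℝ))
  have hpos := integral_fejerKernel_pos
  obtain ⟨a, ha, ha0⟩ := ((h.eventually_const_le (u := 3 / 4 * ∫ v, fejerKernel v)
    (by linarith)).and (eventually_gt_atTop 0)).exists
  refine ⟨a, ha0, ?_⟩
  rwa [id_eq, intervalIntegral.integral_of_le (by linarith)] at ha

lemma le_of_integral_mul_fejerKernel_le {f : ℝ → ℝ}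
    (hf : Integrable fun v => f v * fejerKernel v) {η : ℝ} (hη : 0 ≤ η) (hfη : ∀ v, -η ≤ f v)
    {a : ℝ} (ha : 3 / 4 * ∫ v, fejerKernel v ≤ ∫ v in Set.Ioc (-a) a, fejerKernel v)
    {d : ℝ} (hd : ∀ v ∈ Set.Ioc (-a) a, d ≤ f v) {J : ℝ} (hJ0 : 0 ≤ J)
    (hJ : ∫ v, f v * fejerKernel v ≤ J) :
    d ≤ 4 / (3 * ∫ v, fejerKernel v) * J + η / 3 := by
  have hpos := integral_fejerKernel_pos
  have hJ' : 0 ≤ 4 / (3 * ∫ v, fejerKernel v) * J := by positivity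
  rcases lt_or_ge (d + η) 0 with hneg | hnn
  · linarith
  have hi1 : Integrable ((Set.Ioc (-a) a).indicator fejerKernel) :=
    integrable_fejerKernel.indicator measurableSet_Ioc
  have hle : (d + η) * (∫ v in Set.Ioc (-a) a, fejerKernel v) - η * ∫ v, fejerKernel v
      ≤ ∫ v, f v * fejerKernel v := by
    rw [← integral_indicator measurableSet_Ioc, ← integral_const_mul, ← integral_const_mul,
      ← integral_sub (hi1.const_mul _) (integrable_fejerKernel.const_mul _)]
    refine integral_mono ((hi1.const_mul _).sub (integrable_fejerKernel.const_mul _)) hf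
      fun v => ?_
    have hK := fejerKernel_nonneg v
    by_cases hv : v ∈ Set.Ioc (-a) a
    · simp only [Set.indicator_of_mem hv]
      nlinarith [hd v hv]
    · simp only [Set.indicator_of_notMem hv]
      nlinarith [hfη v]
  have h2 : (d + η) * (3 / 4 * ∫ v, fejerKernel v)
      ≤ (d + η) * ∫ v in Set.Ioc (-a) a, fejerKernel v := mul_le_mul_of_nonneg_left ha hnn
  have h3 : (d + η) * (3 / 4 * ∫ v, fejerKernel v) - η * ∫ v, fejerKernel v ≤ J := by linarith
  have h4 : 4 / (3 * ∫ v, fejerKernel v) * ((d + η) * (3 / 4 * ∫ v, fejerKernel v)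
      - η * ∫ v, fejerKernel v) ≤ 4 / (3 * ∫ v, fejerKernel v) * J := by
    gcongr
  have h5 : 4 / (3 * ∫ v, fejerKernel v) * ((d + η) * (3 / 4 * ∫ v, fejerKernel v)
      - η * ∫ v, fejerKernel v) = d - η / 3 := by
    field_simp
    ring
  linarith

/-- Esseen's smoothing inequality on the unit frequency window. -/
lemma exists_esseen_smoothing : ∃ A : ℝ, 0 < A ∧ ∀ (μ γ : Measure ℝ) [IsProbabilityMeasure μ]
    [IsProbabilityMeasure γ] (ℓ : ℝ) (ψ : ℝ → ℝ), 0 ≤ ℓ →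
    (∀ x s, 0 ≤ s → γ.real (Set.Iic (x + s)) - γ.real (Set.Iic x) ≤ ℓ * s) →
    IntervalIntegrable ψ volume 0 1 →
    (∀ s ∈ Set.Ioc (0 : ℝ) 1, ‖charFun μ s - charFun γ s‖ ≤ s * ψ s) →
    ∀ x, |μ.real (Set.Iic x) - γ.real (Set.Iic x)| ≤ A * (ℓ + ∫ s in (0 : ℝ)..1, ψ s) := by
  obtain ⟨a, ha0, ha⟩ := exists_fejerKernel_window
  have hpos := integral_fejerKernel_pos
  set c := ∫ v, fejerKernel v with hc
  refine ⟨3 / 2 * (2 * a + 8 / (3 * c)), by positivity, ?_⟩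
  intro μ γ _ _ ℓ ψ hℓ hγ hψi h x
  set J := ∫ s in (0 : ℝ)..1, ψ s with hJ
  have hJ0 : 0 ≤ J := by
    have : |∫ v, (μ.real (Set.Iic (0 - v)) - γ.real (Set.Iic (0 - v))) * fejerKernel v| ≤ 2 * J :=
      abs_integral_smoothed_le hψi h 0
    linarith [abs_nonneg (∫ v, (μ.real (Set.Iic (0 - v)) - γ.real (Set.Iic (0 - v))) *
      fejerKernel v)]
  set D : ℝ → ℝ := fun x => μ.real (Set.Iic x) - γ.real (Set.Iic x) with hD
  have hmonoμ : ∀ {x y : ℝ}, x ≤ y → μ.real (Set.Iic x) ≤ μ.real (Set.Iic y) := fun hxy =>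
    measureReal_mono (Set.Iic_subset_Iic.mpr hxy)
  have hmonoγ : ∀ {x y : ℝ}, x ≤ y → γ.real (Set.Iic x) ≤ γ.real (Set.Iic y) := fun hxy =>
    measureReal_mono (Set.Iic_subset_Iic.mpr hxy)
  have hD1 : ∀ x, |D x| ≤ 1 := fun x => by
    have h1 := measureReal_le_one (μ := μ) (s := Set.Iic x)
    have h2 := measureReal_le_one (μ := γ) (s := Set.Iic x)
    have h3 := measureReal_nonneg (μ := μ) (s := Set.Iic x)
    have h4 := measureReal_nonneg (μ := γ) (s := Set.Iic x)
    rw [abs_le]; constructor <;> simp only [hD] <;> linarith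
  have hDm : Measurable D := by
    have h1 : Monotone fun x : ℝ => μ.real (Set.Iic x) := fun _ _ => hmonoμ
    have h2 : Monotone fun x : ℝ => γ.real (Set.Iic x) := fun _ _ => hmonoγ
    exact h1.measurable.sub h2.measurable
  have hbdd : BddAbove (Set.range fun x => |D x|) := ⟨1, by rintro _ ⟨x, rfl⟩; exact hD1 x⟩
  set η := ⨆ x, |D x| with hη
  have hDη : ∀ x, |D x| ≤ η := le_ciSup hbdd
  have hη0 : 0 ≤ η := (abs_nonneg _).trans (hDη 0)
  have hint : ∀ b, Integrable fun v => D (b - v) * fejerKernel v := fun b => by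
    refine integrable_fejerKernel.bdd_mul (c := 1)
      (Measurable.aestronglyMeasurable (by fun_prop)) (ae_of_all _ fun v => hD1 _)
  have hsm : ∀ b, |∫ v, D (b - v) * fejerKernel v| ≤ 2 * J := fun b =>
    abs_integral_smoothed_le hψi h b
  have hstep : ∀ x, |D x| ≤ 2 * a * ℓ + 4 / (3 * c) * (2 * J) + η / 3 := by
    intro x
    rw [abs_le']
    constructor
    · have := le_of_integral_mul_fejerKernel_le (hint (x + a)) hη0
        (fun v => (abs_le.mp (hDη _)).1) ha (d := D x - 2 * a * ℓ) (fun v hv => by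
          have h1 := hγ x (a - v) (by linarith [hv.2])
          have h2 := hmonoμ (x := x) (y := x + a - v) (by linarith [hv.2])
          have h3 : ℓ * (a - v) ≤ ℓ * (2 * a) := by gcongr; linarith [hv.1]
          rw [show x + (a - v) = x + a - v by ring] at h1
          simp only [hD]
          linarith) (by positivity) (abs_le.mp (hsm (x + a))).2
      linarith
    · have := le_of_integral_mul_fejerKernel_le (f := fun v => -D (x - a - v)) (by
          simpa using (hint (x - a)).neg) hη0
        (fun v => neg_le_neg (abs_le.mp (hDη _)).2) ha (d := -D x - 2 * a * ℓ) (fun v hv => by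
          have h1 := hγ (x - a - v) (a + v) (by linarith [hv.1])
          have h2 := hmonoμ (x := x - a - v) (y := x) (by linarith [hv.1])
          have h3 : ℓ * (a + v) ≤ ℓ * (2 * a) := by gcongr; linarith [hv.2]
          rw [show x - a - v + (a + v) = x by ring] at h1
          simp only [hD]
          linarith) (J := 2 * J) (by positivity) (by
            simp only [neg_mul, integral_neg]
            linarith [(abs_le.mp (hsm (x - a))).1])
      linarith
  have hη2 : η ≤ 2 * a * ℓ + 4 / (3 * c) * (2 * J) + η / 3 := ciSup_le hstep
  have hfin := hDη x
  have hexp : 3 / 2 * (2 * a + 8 / (3 * c)) * (ℓ + J) = 3 / 2 * (2 * a * ℓ + 4 / (3 * c) * (2 * J))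
      + 3 / 2 * (8 / (3 * c) * ℓ + 2 * a * J) := by ring
  have hextra : 0 ≤ 8 / (3 * c) * ℓ + 2 * a * J := by positivity
  rw [hexp]
  simp only [hD] at hfin ⊢
  linarith

lemma gaussianReal_real_Iic_add_sub_le (x s : ℝ) (hs : 0 ≤ s) :
    (gaussianReal 0 1).real (Set.Iic (x + s)) - (gaussianReal 0 1).real (Set.Iic x) ≤ s := by
  rw [← measureReal_sdiff (Set.Iic_subset_Iic.mpr (by linarith)) measurableSet_Iic,
    Set.Iic_sdiff_Iic, measureReal_def, gaussianReal_apply _ one_ne_zero]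
  refine ENNReal.toReal_le_of_le_ofReal hs ?_
  calc ∫⁻ y in Set.Ioc x (x + s), gaussianPDF 0 1 y
      ≤ ∫⁻ _ in Set.Ioc x (x + s), 1 := by
        refine lintegral_mono fun y => ?_
        rw [gaussianPDF, ← ENNReal.ofReal_one]
        refine ENNReal.ofReal_le_ofReal ?_
        rw [gaussianPDFReal]
        refine mul_le_one₀ (inv_le_one_of_one_le₀ ?_) (Real.exp_pos _).le
          (Real.exp_le_one_iff.mpr ?_)
        · rw [Real.one_le_sqrt]
          push_cast
          linarith [Real.pi_gt_three]
        · simp only [NNReal.coe_one]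
          have := sq_nonneg (y - 0)
          rw [neg_div]
          linarith [this]
    _ = ENNReal.ofReal s := by simp

/-- Esseen's smoothing inequality against the standard normal law, for a Gaussian-type bound on
the difference of the characteristic functions. -/
lemma exists_esseen_gaussian (c : ℝ) (hc : 0 < c) : ∃ A : ℝ, 0 < A ∧
    ∀ (μ : Measure ℝ) [IsProbabilityMeasure μ] (T D : ℝ), 0 < T →
    (∀ t ∈ Set.Ioc (0 : ℝ) T, ‖charFun μ t - Complex.exp (-(t ^ 2 / 2))‖
      ≤ D * t * Real.exp (-c * t ^ 2)) →
    ∀ x, |μ.real (Set.Iic x) - (gaussianReal 0 1).real (Set.Iic x)| ≤ A * (1 / T + D) := by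
  obtain ⟨A, hA, hmain⟩ := exists_esseen_smoothing
  set G := ∫ t : ℝ, Real.exp (-c * t ^ 2) with hG
  have hG0 : 0 ≤ G := integral_nonneg fun t => (Real.exp_pos _).le
  refine ⟨A * (1 + G), by positivity, ?_⟩
  intro μ _ T D hT h x
  have hD : 0 ≤ D := by
    have h1 := (norm_nonneg _).trans (h T ⟨hT, le_rfl⟩)
    have h2 : 0 < T * Real.exp (-c * T ^ 2) := by positivity
    rw [mul_assoc] at h1
    exact nonneg_of_mul_nonneg_left h1 h2
  have hm : Measurable fun y : ℝ => T * y := by fun_prop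
  have : IsProbabilityMeasure (μ.map fun y => T * y) :=
    Measure.isProbabilityMeasure_map hm.aemeasurable
  have : IsProbabilityMeasure ((gaussianReal 0 1).map fun y => T * y) :=
    Measure.isProbabilityMeasure_map hm.aemeasurable
  have hIic : ∀ (μ : Measure ℝ) (x : ℝ), (μ.map fun y => T * y).real (Set.Iic x)
      = μ.real (Set.Iic (x / T)) := by
    intro μ x
    rw [map_measureReal_apply hm measurableSet_Iic]
    congr 1
    ext y
    simp [le_div_iff₀ hT, mul_comm]
  have hcont : Continuous fun s : ℝ => D * (T * Real.exp (-c * (T * s) ^ 2)) := by fun_prop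
  have key := hmain (μ.map fun y => T * y) ((gaussianReal 0 1).map fun y => T * y) (1 / T)
    (fun s => D * (T * Real.exp (-c * (T * s) ^ 2))) (by positivity) (fun x s hs => by
      rw [hIic, hIic, add_div]
      refine (gaussianReal_real_Iic_add_sub_le _ _ (by positivity)).trans_eq ?_
      ring) (hcont.intervalIntegrable _ _) (fun s hs => by
      rw [charFun_map_mul, charFun_map_mul, charFun_gaussianReal]
      have := h (T * s) ⟨mul_pos hT hs.1, by nlinarith [hs.2]⟩
      convert this using 1
      · congr 3
        push_cast
        simp
      · ring) (T * x)
  rw [hIic, hIic, mul_div_cancel_left₀ _ hT.ne'] at key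
  refine key.trans ?_
  have hint : ∫ s in (0 : ℝ)..1, D * (T * Real.exp (-c * (T * s) ^ 2)) ≤ D * G := by
    rw [intervalIntegral.integral_const_mul, intervalIntegral.integral_const_mul,
      intervalIntegral.mul_integral_comp_mul_left (f := fun t => Real.exp (-c * t ^ 2))]
    refine mul_le_mul_of_nonneg_left ?_ hD
    rw [mul_zero, mul_one, intervalIntegral.integral_of_le hT.le]
    exact setIntegral_le_integral (integrable_exp_neg_mul_sq hc)
      (ae_of_all _ fun t => (Real.exp_pos _).le)
  have h1T : 0 ≤ 1 / T := by positivity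
  calc _ ≤ A * (1 / T + D * G) := by gcongr
    _ ≤ A * (1 + G) * (1 / T + D) := by
      rw [mul_assoc]
      gcongr
      nlinarith

/-! ### Twisted transition operators on `V`-bounded functions -/

section Operators

variable {E : Type*} [MeasurableSpace E]

/-- Measurable complex functions dominated by a multiple of `V`. -/
def vBounded (V : E → ℝ) : Submodule ℂ (E → ℂ) where
  carrier := {f | Measurable f ∧ ∃ M, ∀ x, ‖f x‖ ≤ M * V x}
  add_mem' := by
    rintro f g ⟨hf, M, hM⟩ ⟨hg, N, hN⟩
    refine ⟨hf.add hg, M + N, fun x => (norm_add_le _ _).trans ?_⟩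
    rw [add_mul]
    exact add_le_add (hM x) (hN x)
  zero_mem' := ⟨measurable_const, 0, by simp⟩
  smul_mem' := by
    rintro c f ⟨hf, M, hM⟩
    refine ⟨hf.const_smul c, ‖c‖ * M, fun x => ?_⟩
    simp only [Pi.smul_apply, norm_smul, mul_assoc]
    exact mul_le_mul_of_nonneg_left (hM x) (norm_nonneg _)

/-- The drift bound `Q V ≤ D V` for a measurable function `V ≥ 1`. -/
structure DriftBound (Q : Kernel E E) (V : E → ℝ) (D : ℝ) : Prop where
  measurable : Measurable V
  one_le : ∀ x, 1 ≤ V x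
  integrable : ∀ x, Integrable V (Q x)
  integral_le : ∀ x, ∫ y, V y ∂(Q x) ≤ D * V x

variable {Q : Kernel E E} {V : E → ℝ} {D : ℝ} {ν : Measure E}

lemma integrable_of_vBounded {ρ : Measure E} (hV : Integrable V ρ) (f : vBounded V) :
    Integrable f.1 ρ := by
  obtain ⟨hf, M, hM⟩ := f.2
  exact (hV.const_mul M).mono' hf.aestronglyMeasurable (ae_of_all _ hM)

lemma exists_bound_of_vBounded (hV : ∀ x, 1 ≤ V x) (f : vBounded V) :
    ∃ M, 0 ≤ M ∧ ∀ x, ‖f.1 x‖ ≤ M * V x := by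
  obtain ⟨-, M, hM⟩ := f.2
  refine ⟨|M|, abs_nonneg _, fun x => (hM x).trans ?_⟩
  exact mul_le_mul_of_nonneg_right (le_abs_self M) (zero_le_one.trans (hV x))

lemma DriftBound.pos (h : DriftBound Q V D) (x : E) : 0 < V x := zero_lt_one.trans_le (h.one_le x)

/-- The constant function `1` as a `V`-bounded function. -/
def DriftBound.one (h : DriftBound Q V D) : vBounded V :=
  ⟨fun _ => 1, measurable_const, 1, fun x => by simpa using h.one_le x⟩

/-- `V` itself as a `V`-bounded function. -/
def DriftBound.weight (h : DriftBound Q V D) : vBounded V :=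
  ⟨fun x => (V x : ℂ), Complex.measurable_ofReal.comp h.measurable, 1, fun x => by
    rw [Complex.norm_real, Real.norm_of_nonneg (h.pos x).le, one_mul]⟩

lemma DriftBound.norm_integral_le (h : DriftBound Q V D) {f : E → ℂ} {M : ℝ} (hM : 0 ≤ M)
    (hf : ∀ x, ‖f x‖ ≤ M * V x) (x : E) : ‖∫ y, f y ∂(Q x)‖ ≤ M * D * V x := by
  refine (norm_integral_le_of_norm_le ((h.integrable x).const_mul M) (ae_of_all _ hf)).trans ?_
  rw [integral_const_mul, mul_assoc]
  exact mul_le_mul_of_nonneg_left (h.integral_le x) hM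

/-- The transition operator on `V`-bounded functions. -/
noncomputable def markovOp [IsMarkovKernel Q] (h : DriftBound Q V D) :
    Module.End ℂ (vBounded V) where
  toFun f := ⟨fun x => ∫ y, f.1 y ∂(Q x), by
    obtain ⟨hf, -⟩ := f.2
    obtain ⟨M, hM0, hM⟩ := exists_bound_of_vBounded h.one_le f
    exact ⟨hf.stronglyMeasurable.integral_kernel.measurable, M * D, h.norm_integral_le hM0 hM⟩⟩
  map_add' f g := by
    ext x
    exact integral_add (integrable_of_vBounded (h.integrable x) f)
      (integrable_of_vBounded (h.integrable x) g)
  map_smul' c _ := by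
    ext x
    exact integral_const_mul c _

/-- Multiplication by `exp (i t ξ)` on `V`-bounded functions. -/
noncomputable def phaseOp (V : E → ℝ) {ξ : E → ℝ} (hξ : Measurable ξ) (t : ℝ) :
    Module.End ℂ (vBounded V) where
  toFun f := ⟨fun x => Complex.exp (t * ξ x * Complex.I) * f.1 x, by
    obtain ⟨hf, M, hM⟩ := f.2
    refine ⟨by fun_prop, M, fun x => ?_⟩
    rw [norm_mul, ← Complex.ofReal_mul, Complex.norm_exp_ofReal_mul_I, one_mul]
    exact hM x⟩
  map_add' f g := by
    ext x
    exact mul_add _ _ _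
  map_smul' c f := by
    ext x
    exact mul_left_comm _ _ _

/-- Integration against `ν` as a linear functional on `V`-bounded functions. -/
noncomputable def meanOp (hν : Integrable V ν) : vBounded V →ₗ[ℂ] ℂ where
  toFun f := ∫ y, f.1 y ∂ν
  map_add' f g := integral_add (integrable_of_vBounded hν f) (integrable_of_vBounded hν g)
  map_smul' c _ := integral_const_mul c _

lemma norm_meanOp_le (hν : Integrable V ν) {f : vBounded V} {M : ℝ}
    (hf : ∀ x, ‖f.1 x‖ ≤ M * V x) : ‖meanOp hν f‖ ≤ M * ∫ x, V x ∂ν := by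
  refine (norm_integral_le_of_norm_le (hν.const_mul M) (ae_of_all _ hf)).trans_eq ?_
  rw [integral_const_mul]

section Markov

variable [IsMarkovKernel Q] (h : DriftBound Q V D) {ξ : E → ℝ} (hξ : Measurable ξ)

/-- The Fourier-perturbed transition operator `f ↦ Q (exp (i t ξ) f)`. -/
noncomputable def twistedOp (t : ℝ) : Module.End ℂ (vBounded V) := markovOp h * phaseOp V hξ t

lemma norm_phaseOp (t : ℝ) (f : vBounded V) (x : E) : ‖(phaseOp V hξ t f).1 x‖ = ‖f.1 x‖ := by
  change ‖Complex.exp (t * ξ x * Complex.I) * f.1 x‖ = _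
  rw [norm_mul, ← Complex.ofReal_mul, Complex.norm_exp_ofReal_mul_I, one_mul]

lemma norm_markovOp_le {f : vBounded V} {M : ℝ} (hM : 0 ≤ M)
    (hf : ∀ x, ‖f.1 x‖ ≤ M * V x) (x : E) : ‖(markovOp h f).1 x‖ ≤ M * D * V x :=
  h.norm_integral_le hM hf x

lemma norm_twistedOp_le (t : ℝ) {f : vBounded V} {M : ℝ} (hM : 0 ≤ M)
    (hf : ∀ x, ‖f.1 x‖ ≤ M * V x) (x : E) : ‖(twistedOp h hξ t f).1 x‖ ≤ M * D * V x :=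
  norm_markovOp_le h hM (fun y => (norm_phaseOp hξ t f y).trans_le (hf y)) x

lemma norm_markovOp_le_re {f u : vBounded V} (hfu : ∀ x, ‖f.1 x‖ ≤ (u.1 x).re) (x : E) :
    ‖(markovOp h f).1 x‖ ≤ ((markovOp h u).1 x).re := by
  have hu := integrable_of_vBounded (h.integrable x) u
  refine (norm_integral_le_of_norm_le hu.re (ae_of_all _ hfu)).trans_eq ?_
  exact integral_re hu

lemma norm_twistedOp_pow_le_re (t : ℝ) {f u : vBounded V} (hfu : ∀ x, ‖f.1 x‖ ≤ (u.1 x).re)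
    (n : ℕ) : ∀ x, ‖((twistedOp h hξ t ^ n) f).1 x‖ ≤ (((markovOp h ^ n) u).1 x).re := by
  induction n with
  | zero => simpa using hfu
  | succ n ih =>
    intro x
    rw [pow_succ', pow_succ']
    exact norm_markovOp_le_re h (fun y => (norm_phaseOp hξ t _ y).trans_le (ih y)) x

lemma norm_markovOp_pow_le_re {f u : vBounded V} (hfu : ∀ x, ‖f.1 x‖ ≤ (u.1 x).re)
    (n : ℕ) : ∀ x, ‖((markovOp h ^ n) f).1 x‖ ≤ (((markovOp h ^ n) u).1 x).re := by
  induction n with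
  | zero => simpa using hfu
  | succ n ih =>
    intro x
    rw [pow_succ']
    exact norm_markovOp_le_re h ih x

lemma markovOp_one : markovOp h h.one = h.one := by
  ext x
  change ∫ _, (1 : ℂ) ∂(Q x) = 1
  simp

lemma norm_markovOp_pow_le_of_bounded {f : vBounded V} {M : ℝ} (hf : ∀ x, ‖f.1 x‖ ≤ M)
    (n : ℕ) (x : E) : ‖((markovOp h ^ n) f).1 x‖ ≤ M := by
  have h1 : ∀ n, (markovOp h ^ n) h.one = h.one := by
    intro n
    induction n with
    | zero => simp
    | succ n ih => rw [pow_succ', Module.End.mul_apply, ih, markovOp_one]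
  have h2 := norm_markovOp_pow_le_re h (f := f) (u := (M : ℂ) • h.one)
    (fun x => by simpa [DriftBound.one] using hf x) n x
  rw [map_smul, h1] at h2
  simpa [DriftBound.one] using h2

end Markov

end Operators

section Ergodic

set_option linter.unusedSectionVars false

variable {E : Type*} [MeasurableSpace E] {Q : Kernel E E} [IsMarkovKernel Q] {V : E → ℝ} {D : ℝ}
  {ν : Measure E} [IsProbabilityMeasure ν]

/-- `V`-geometric ergodicity, for all powers of the transition operator. -/
structure GeomErgodic (h : DriftBound Q V D) (hν : Integrable V ν) (C κ : ℝ) : Prop where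
  C_nonneg : 0 ≤ C
  κ_pos : 0 < κ
  κ_lt_one : κ < 1
  bound : ∀ (n : ℕ) (f : vBounded V) (M : ℝ), 0 ≤ M → (∀ x, ‖f.1 x‖ ≤ M * V x) →
    ∀ x, ‖((markovOp h ^ n) f).1 x - meanOp hν f‖ ≤ C * κ ^ n * M * V x

variable {h : DriftBound Q V D} {hν : Integrable V ν} {C κ : ℝ}

lemma DriftBound.D_nonneg (h : DriftBound Q V D) [Nonempty E] : 0 ≤ D := by
  obtain ⟨x⟩ := ‹Nonempty E›
  have h1 : 0 ≤ ∫ y, V y ∂(Q x) := integral_nonneg fun y => (h.pos y).le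
  exact nonneg_of_mul_nonneg_left (h1.trans (h.integral_le x)) (h.pos x)

lemma one_le_integral_weight (h : DriftBound Q V D) (hν : Integrable V ν) : 1 ≤ ∫ x, V x ∂ν := by
  have := integral_mono (integrable_const (1 : ℝ)) hν h.one_le
  simpa using this

namespace GeomErgodic

lemma tendsto_markovOp_pow (H : GeomErgodic h hν C κ) (f : vBounded V) (x : E) :
    Tendsto (fun n => ((markovOp h ^ n) f).1 x) atTop (nhds (meanOp hν f)) := by
  obtain ⟨M, hM0, hM⟩ := exists_bound_of_vBounded h.one_le f
  rw [tendsto_iff_norm_sub_tendsto_zero]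
  refine squeeze_zero (fun _ => norm_nonneg _) (fun n => H.bound n f M hM0 hM x) ?_
  have := tendsto_pow_atTop_nhds_zero_of_lt_one H.κ_pos.le H.κ_lt_one
  simpa using ((this.const_mul C).mul_const M).mul_const (V x)

lemma meanOp_markovOp [Nonempty E] (H : GeomErgodic h hν C κ) (f : vBounded V) :
    meanOp hν (markovOp h f) = meanOp hν f := by
  obtain ⟨x⟩ := ‹Nonempty E›
  refine tendsto_nhds_unique (H.tendsto_markovOp_pow (markovOp h f) x) ?_
  simp_rw [← Module.End.mul_apply, ← pow_succ]
  exact (H.tendsto_markovOp_pow f x).comp (tendsto_add_atTop_nat 1)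

lemma norm_markovOp_pow_weight_le (H : GeomErgodic h hν C κ) (n : ℕ) (x : E) :
    ((((markovOp h ^ n) h.weight).1 x).re) ≤ (∫ x, V x ∂ν) + C * κ ^ n * V x := by
  have h0 : ∀ x, ‖h.weight.1 x‖ ≤ 1 * V x := fun x => by
    simp [DriftBound.weight, abs_of_nonneg (h.pos x).le]
  have h1 := H.bound n h.weight 1 zero_le_one h0 x
  have h2 := norm_meanOp_le hν h0
  have h3 : ‖((markovOp h ^ n) h.weight).1 x‖ ≤
      ‖((markovOp h ^ n) h.weight).1 x - meanOp hν h.weight‖ + ‖meanOp hν h.weight‖ := by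
    simpa using norm_add_le (((markovOp h ^ n) h.weight).1 x - meanOp hν h.weight)
      (meanOp hν h.weight)
  have h4 := Complex.re_le_norm (((markovOp h ^ n) h.weight).1 x)
  linarith

variable {ξ : E → ℝ} (hξ : Measurable ξ)

lemma norm_twistedOp_pow_le (H : GeomErgodic h hν C κ) (t : ℝ) {f : vBounded V} {M : ℝ}
    (hM : 0 ≤ M) (hf : ∀ x, ‖f.1 x‖ ≤ M * V x) (n : ℕ) (x : E) :
    ‖((twistedOp h hξ t ^ n) f).1 x‖ ≤ M * ((∫ x, V x ∂ν) + C * κ ^ n * V x) := by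
  have h1 := norm_twistedOp_pow_le_re h hξ t (f := f) (u := (M : ℂ) • h.weight)
    (fun x => by simpa [DriftBound.weight] using hf x) n x
  rw [map_smul] at h1
  refine h1.trans ?_
  change ((M : ℂ) * ((markovOp h ^ n) h.weight).1 x).re ≤ _
  rw [Complex.re_ofReal_mul]
  exact mul_le_mul_of_nonneg_left (H.norm_markovOp_pow_weight_le n x) hM

lemma norm_twistedOp_pow_le' (H : GeomErgodic h hν C κ) (t : ℝ) {f : vBounded V} {M : ℝ}
    (hM : 0 ≤ M) (hf : ∀ x, ‖f.1 x‖ ≤ M * V x) (n : ℕ) (x : E) :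
    ‖((twistedOp h hξ t ^ n) f).1 x‖ ≤ M * ((∫ x, V x ∂ν) + C) * V x := by
  refine (H.norm_twistedOp_pow_le hξ t hM hf n x).trans ?_
  rw [mul_assoc M]
  refine mul_le_mul_of_nonneg_left ?_ hM
  have h1 := one_le_integral_weight h hν
  have h2 : C * κ ^ n ≤ C :=
    mul_le_of_le_one_right H.C_nonneg (pow_le_one₀ H.κ_pos.le H.κ_lt_one.le)
  nlinarith [h.one_le x, mul_le_mul_of_nonneg_right h2 (h.pos x).le]

end GeomErgodic

lemma norm_exp_ofReal_mul_I_sub_one_le (s : ℝ) : ‖Complex.exp (s * Complex.I) - 1‖ ≤ |s| := by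
  simpa [mul_comm] using Real.norm_exp_I_mul_ofReal_sub_one_le (x := s)

variable {ξ : E → ℝ} (hξ : Measurable ξ)

lemma norm_twistedOp_sub_markovOp_le (h : DriftBound Q V D) {b : ℝ} (hb : ∀ x, |ξ x| ≤ b * V x)
    (t : ℝ) {f : vBounded V} {M : ℝ} (hM : 0 ≤ M) (hf : ∀ x, ‖f.1 x‖ ≤ M) (x : E) :
    ‖(twistedOp h hξ t f).1 x - (markovOp h f).1 x‖ ≤ |t| * b * D * M * V x := by
  have hb0 : 0 ≤ b := nonneg_of_mul_nonneg_left ((abs_nonneg _).trans (hb x)) (h.pos x)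
  have h1 := norm_markovOp_le h (f := phaseOp V hξ t f - f) (M := |t| * b * M) (by positivity)
    (fun y => by
      change ‖Complex.exp (t * ξ y * Complex.I) * f.1 y - f.1 y‖ ≤ _
      rw [← sub_one_mul, norm_mul, ← Complex.ofReal_mul]
      calc _ ≤ |t * ξ y| * M :=
            mul_le_mul (norm_exp_ofReal_mul_I_sub_one_le _) (hf y) (norm_nonneg _) (abs_nonneg _)
        _ ≤ |t| * (b * V y) * M := by
            rw [abs_mul]
            gcongr
            exact hb y
        _ = _ := by ring) x
  rw [map_sub] at h1
  calc _ ≤ _ := h1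
    _ = _ := by ring

lemma exists_norm_twistedOp_pow_sub_le (h : DriftBound Q V D) {b : ℝ}
    (hb : ∀ x, |ξ x| ≤ b * V x) (m : ℕ) :
    ∃ A : ℝ, 0 ≤ A ∧ ∀ (t : ℝ) (f : vBounded V) (M : ℝ), 0 ≤ M → (∀ x, ‖f.1 x‖ ≤ M) → ∀ x,
      ‖((twistedOp h hξ t ^ m) f).1 x - ((markovOp h ^ m) f).1 x‖ ≤ |t| * A * M * V x := by
  rcases isEmpty_or_nonempty E with hE | hE
  · exact ⟨0, le_rfl, fun _ _ _ _ _ x => (hE.false x).elim⟩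
  have hD := h.D_nonneg
  have hb0 : 0 ≤ b := nonneg_of_mul_nonneg_left
    ((abs_nonneg _).trans (hb hE.some)) (h.pos hE.some)
  induction m with
  | zero => exact ⟨0, le_rfl, fun t f M hM hf x => by simp⟩
  | succ m ih =>
    obtain ⟨A, hA, ih⟩ := ih
    refine ⟨A * D + b * D, by positivity, fun t f M hM hf x => ?_⟩
    have h1 := norm_twistedOp_le h hξ t
      (f := (twistedOp h hξ t ^ m) f - (markovOp h ^ m) f) (M := |t| * A * M) (by positivity)
      (ih t f M hM hf) x
    have h2 := norm_twistedOp_sub_markovOp_le hξ h hb t hM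
      (norm_markovOp_pow_le_of_bounded h hf m) x
    rw [map_sub] at h1
    rw [pow_succ', pow_succ', Module.End.mul_apply, Module.End.mul_apply]
    refine (norm_sub_le_norm_sub_add_norm_sub _
      ((twistedOp h hξ t ((markovOp h ^ m) f)).1 x) _).trans ?_
    refine (add_le_add h1 h2).trans_eq ?_
    ring

/-- A power of the twisted operator is close to the rank-one operator `f ↦ ν(f) 1` in a
weighted supremum norm, uniformly for small `t`. -/
lemma GeomErgodic.exists_norm_twistedOp_pow_sub_meanOp_le (H : GeomErgodic h hν C κ) {b : ℝ}
    (hb : ∀ x, |ξ x| ≤ b * V x) {ε : ℝ} (hε : 0 < ε) :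
    ∃ β : ℝ, 0 < β ∧ 2 * β * ∫ x, V x ∂ν ≤ ε ∧ ∃ m : ℕ, 1 ≤ m ∧ ∃ α : ℝ, 0 < α ∧ ∀ t : ℝ, |t| ≤ α →
      ∀ (f : vBounded V) (M : ℝ), 0 ≤ M → (∀ x, ‖f.1 x‖ ≤ M * (1 + β * V x)) → ∀ x,
      ‖((twistedOp h hξ t ^ m) f).1 x - meanOp hν f‖ ≤ ε * M * (1 + β * V x) := by
  have hN := one_le_integral_weight h hν
  set N := ∫ x, V x ∂ν
  obtain ⟨β, hβ, hβ1, hβN⟩ : ∃ β : ℝ, 0 < β ∧ β ≤ 1 ∧ 2 * β * N ≤ ε := by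
    refine ⟨min 1 (ε / (2 * N)), by positivity, min_le_left _ _, ?_⟩
    calc 2 * min 1 (ε / (2 * N)) * N ≤ 2 * (ε / (2 * N)) * N := by
          gcongr
          exact min_le_right _ _
      _ = ε := by field_simp
  obtain ⟨m, hm1, hm⟩ : ∃ m : ℕ, 1 ≤ m ∧ 2 * (C * κ ^ m) ≤ ε * β / 2 := by
    have h1 : Tendsto (fun n : ℕ => 2 * (C * κ ^ n)) atTop (nhds (2 * (C * 0))) :=
      ((tendsto_pow_atTop_nhds_zero_of_lt_one H.κ_pos.le H.κ_lt_one).const_mul C).const_mul 2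
    have h2 : 2 * (C * 0) < ε * β / 2 := by simp; positivity
    obtain ⟨m, hm⟩ := ((h1.eventually_le_const h2).and (eventually_ge_atTop 1)).exists
    exact ⟨m, hm.2, hm.1⟩
  obtain ⟨A, hA, hAm⟩ := exists_norm_twistedOp_pow_sub_le hξ h hb m
  refine ⟨β, hβ, hβN, m, hm1, ε * β / 2 / (A + 1), by positivity, fun t ht f M hM hf x => ?_⟩
  have htA : |t| * A ≤ ε * β / 2 := by
    calc |t| * A ≤ ε * β / 2 / (A + 1) * (A + 1) := by gcongr; linarith
      _ = _ := by field_simp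
  have hW : ∀ x, 0 < 1 + β * V x := fun x => by have := h.pos x; positivity
  have hVm := h.measurable
  have hfm := f.2.1
  let f₁ : vBounded V := ⟨fun x => f.1 x / ((1 + β * V x : ℝ) : ℂ), by fun_prop, M, fun x => by
    rw [norm_div, Complex.norm_real, Real.norm_of_nonneg (hW x).le, div_le_iff₀ (hW x)]
    refine (hf x).trans ?_
    have := mul_le_mul_of_nonneg_left (h.one_le x) (mul_nonneg hM (hW x).le)
    linarith⟩
  have hf₁ : ∀ x, ‖f₁.1 x‖ ≤ M := fun x => by
    change ‖f.1 x / ((1 + β * V x : ℝ) : ℂ)‖ ≤ M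
    rw [norm_div, Complex.norm_real, Real.norm_of_nonneg (hW x).le, div_le_iff₀ (hW x)]
    exact hf x
  have hf₂ : ∀ x, ‖(f - f₁).1 x‖ ≤ M * β * V x := fun x => by
    have h1 : (f - f₁).1 x = f₁.1 x * ((β * V x : ℝ) : ℂ) := by
      change f.1 x - f.1 x / ((1 + β * V x : ℝ) : ℂ) =
        f.1 x / ((1 + β * V x : ℝ) : ℂ) * ((β * V x : ℝ) : ℂ)
      have : ((1 + β * V x : ℝ) : ℂ) ≠ 0 := Complex.ofReal_ne_zero.2 (hW x).ne'
      field_simp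
      push_cast
      ring
    rw [h1, norm_mul, Complex.norm_real,
      Real.norm_of_nonneg (mul_nonneg hβ.le (h.pos x).le), mul_assoc]
    exact mul_le_mul_of_nonneg_right (hf₁ x) (mul_nonneg hβ.le (h.pos x).le)
  have hf₁' : ∀ x, ‖f₁.1 x‖ ≤ M * V x := fun x =>
    (hf₁ x).trans (le_mul_of_one_le_right hM (h.one_le x))
  have e1 := hAm t f₁ M hM hf₁ x
  have e2 := H.bound m f₁ M hM hf₁' x
  have e3 := H.norm_twistedOp_pow_le hξ t (by positivity) hf₂ m x
  have e4 := norm_meanOp_le hν hf₂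
  rw [map_sub] at e3 e4
  have key : ((twistedOp h hξ t ^ m) f).1 x - meanOp hν f =
      (((twistedOp h hξ t ^ m) f₁).1 x - ((markovOp h ^ m) f₁).1 x) +
      (((markovOp h ^ m) f₁).1 x - meanOp hν f₁) +
      ((twistedOp h hξ t ^ m) f - (twistedOp h hξ t ^ m) f₁).1 x -
      (meanOp hν f - meanOp hν f₁) := by
    change _ = _ + _ + (((twistedOp h hξ t ^ m) f).1 x - ((twistedOp h hξ t ^ m) f₁).1 x) - _
    ring
  rw [key]
  refine (norm_sub_le _ _).trans ((add_le_add (norm_add₃_le.trans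
    (add_le_add (add_le_add e1 e2) e3)) e4).trans ?_)
  have hCκ : 0 ≤ C * κ ^ m := mul_nonneg H.C_nonneg (pow_nonneg H.κ_pos.le m)
  have g1 : |t| * A * (M * V x) ≤ ε * β / 2 * (M * V x) :=
    mul_le_mul_of_nonneg_right htA (mul_nonneg hM (h.pos x).le)
  have g2 : 2 * (C * κ ^ m) * (M * V x) ≤ ε * β / 2 * (M * V x) :=
    mul_le_mul_of_nonneg_right hm (mul_nonneg hM (h.pos x).le)
  have g3 : 2 * β * N * M ≤ ε * M := mul_le_mul_of_nonneg_right hβN hM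
  have g4 : β * (C * κ ^ m * (M * V x)) ≤ 1 * (C * κ ^ m * (M * V x)) :=
    mul_le_mul_of_nonneg_right hβ1 (mul_nonneg hCκ (mul_nonneg hM (h.pos x).le))
  linarith

end Ergodic

section Poisson

set_option linter.unusedSectionVars false

variable {E : Type*} [MeasurableSpace E] {Q : Kernel E E} [IsMarkovKernel Q] {V U : E → ℝ} {D : ℝ}
  {ν : Measure E} [IsProbabilityMeasure ν] {h : DriftBound Q V D} {hν : Integrable V ν} {C θ : ℝ}

lemma GeomErgodic.norm_markovOp_pow_sub_le (H : GeomErgodic h hν C (θ ^ 3)) (hθ0 : 0 < θ)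
    (hθ1 : θ < 1) (hU : Measurable U) (hU1 : ∀ x, 1 ≤ U x) (hUV : ∀ x, U x ^ 3 = V x) {p q : ℕ}
    (hp : 1 ≤ p) (hpq : p + q = 3) {f : vBounded V} {M : ℝ} (hM : 0 ≤ M)
    (hf : ∀ x, ‖f.1 x‖ ≤ M * U x ^ p) (n : ℕ) (x : E) :
    ‖((markovOp h ^ n) f).1 x - meanOp hν f‖ ≤ (2 + C) * M * U x ^ p * θ ^ n := by
  classical
  have hU0 : ∀ x, 0 < U x := fun x => zero_lt_one.trans_le (hU1 x)
  have hθn : 0 < θ ^ n := pow_pos hθ0 n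
  set R := U x * θ ^ n with hR
  have hR0 : 0 < R := mul_pos (hU0 x) hθn
  have hA : MeasurableSet {y | U y ≤ R} := measurableSet_le hU measurable_const
  obtain ⟨-, N, hN⟩ := f.2
  let f₁ : vBounded V := ⟨{y | U y ≤ R}.indicator f.1, f.2.1.indicator hA, N, fun y =>
    (norm_indicator_le_norm_self _ _).trans (hN y)⟩
  have hf₁ : ∀ y, ‖f₁.1 y‖ ≤ M * R ^ p := fun y => by
    change ‖{y | U y ≤ R}.indicator f.1 y‖ ≤ _
    rw [Set.indicator_apply]
    split_ifs with hy
    · refine (hf y).trans (mul_le_mul_of_nonneg_left ?_ hM)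
      exact pow_le_pow_left₀ (hU0 y).le hy p
    · simp only [norm_zero]; positivity
  have hf₂ : ∀ y, ‖(f - f₁).1 y‖ ≤ M / R ^ q * V y := fun y => by
    change ‖f.1 y - {y | U y ≤ R}.indicator f.1 y‖ ≤ _
    rw [Set.indicator_apply]
    split_ifs with hy
    · simp only [sub_self, norm_zero]
      have := h.pos y
      positivity
    · rw [sub_zero]
      refine (hf y).trans ?_
      rw [div_mul_eq_mul_div, le_div_iff₀ (pow_pos hR0 q), mul_assoc, ← hUV y, ← hpq, pow_add]
      have : R ^ q ≤ U y ^ q := pow_le_pow_left₀ hR0.le (le_of_not_ge hy) q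
      exact mul_le_mul_of_nonneg_left
        (mul_le_mul_of_nonneg_left this (pow_pos (hU0 y) p).le) hM
  have e1 := norm_markovOp_pow_le_of_bounded h hf₁ n x
  have e2 : ‖meanOp hν f₁‖ ≤ M * R ^ p := by
    have := norm_integral_le_of_norm_le_const (μ := ν) (ae_of_all _ hf₁)
    rwa [probReal_univ, mul_one] at this
  have e3 := H.bound n (f - f₁) (M / R ^ q) (by positivity) hf₂ x
  have e4 : C * (θ ^ 3) ^ n * (M / R ^ q) * V x = C * (M * R ^ p) := by
    rw [← hUV x, ← pow_mul, mul_comm 3 n, pow_mul]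
    have : (θ ^ n) ^ 3 * U x ^ 3 = R ^ p * R ^ q := by
      rw [← mul_pow, mul_comm, ← hR, ← pow_add, hpq]
    field_simp
    linear_combination C * M * this
  have e5 : R ^ p ≤ U x ^ p * θ ^ n := by
    rw [hR, mul_pow]
    have : (θ ^ n) ^ p ≤ θ ^ n :=
      pow_le_of_le_one hθn.le (pow_le_one₀ hθ0.le hθ1.le) (by omega)
    exact mul_le_mul_of_nonneg_left this (pow_pos (hU0 x) p).le
  have key : ((markovOp h ^ n) f).1 x - meanOp hν f =
      ((markovOp h ^ n) f₁).1 x - meanOp hν f₁ +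
      (((markovOp h ^ n) (f - f₁)).1 x - meanOp hν (f - f₁)) := by
    rw [map_sub, map_sub]
    change _ = _ - _ + (((markovOp h ^ n) f).1 x - ((markovOp h ^ n) f₁).1 x - _)
    ring
  rw [e4] at e3
  rw [key]
  refine (norm_add_le _ _).trans ((add_le_add ((norm_sub_le _ _).trans
    (add_le_add e1 e2)) e3).trans ?_)
  have e6 := mul_le_mul_of_nonneg_left e5 (mul_nonneg (add_nonneg zero_le_two H.C_nonneg) hM)
  linarith

lemma GeomErgodic.exists_poisson (H : GeomErgodic h hν C (θ ^ 3)) (hθ0 : 0 < θ)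
    (hθ1 : θ < 1) (hU : Measurable U) (hU1 : ∀ x, 1 ≤ U x) (hUV : ∀ x, U x ^ 3 = V x) {p q : ℕ}
    (hp : 1 ≤ p) (hpq : p + q = 3) {F : vBounded V} {M : ℝ} (hM : 0 ≤ M)
    (hF : ∀ x, ‖F.1 x‖ ≤ M * U x ^ p) (hF0 : meanOp hν F = 0) :
    ∃ (G : vBounded V) (M' : ℝ), 0 ≤ M' ∧ (∀ x, ‖G.1 x‖ ≤ M' * U x ^ p) ∧ G = F + markovOp h G ∧
      meanOp hν G = 0 ∧
      ∀ x, Tendsto (fun N => (∑ n ∈ Finset.range N, (markovOp h ^ n) F).1 x) atTop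
        (nhds (G.1 x)) := by
  rcases isEmpty_or_nonempty E with hE | hE
  · exact (NeZero.ne ν (Measure.eq_zero_of_isEmpty ν)).elim
  have hU0 : ∀ x, 0 < U x := fun x => zero_lt_one.trans_le (hU1 x)
  have hD := h.D_nonneg
  have hC := H.C_nonneg
  let s : ℕ → vBounded V := fun N => ∑ n ∈ Finset.range N, (markovOp h ^ n) F
  have hs : ∀ N x, (s (N + 1)).1 x = (s N).1 x + ((markovOp h ^ N) F).1 x := fun N x => by
    simp only [s, Finset.sum_range_succ]
    rfl
  have hdist : ∀ x N, dist ((s N).1 x) ((s (N + 1)).1 x) ≤ (2 + C) * M * U x ^ p * θ ^ N :=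
    fun x N => by
      rw [dist_comm, dist_eq_norm, hs, add_sub_cancel_left]
      simpa [hF0] using H.norm_markovOp_pow_sub_le hθ0 hθ1 hU hU1 hUV hp hpq hM hF N x
  choose G hG using fun x =>
    cauchySeq_tendsto_of_complete (cauchySeq_of_le_geometric θ _ hθ1 (hdist x))
  have hGs : ∀ x N, ‖(s N).1 x - G x‖ ≤ (2 + C) * M / (1 - θ) * θ ^ N * U x ^ p := fun x N => by
    rw [← dist_eq_norm]
    refine (dist_le_of_le_geometric_of_tendsto θ _ hθ1 (hdist x) (hG x) N).trans_eq ?_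
    ring
  set M' := (2 + C) * M / (1 - θ) with hM'
  have hM'0 : 0 ≤ M' := div_nonneg (by positivity) (sub_pos.2 hθ1).le
  have hGM : ∀ x, ‖G x‖ ≤ M' * U x ^ p := fun x => by
    have := hGs x 0
    simpa [s] using this
  have hUp : ∀ x, U x ^ p ≤ V x := fun x => by
    rw [← hUV]
    exact pow_le_pow_right₀ (hU1 x) (by omega)
  have hGm : Measurable G :=
    measurable_of_tendsto_metrizable (fun N => (s N).2.1) (tendsto_pi_nhds.2 hG)
  let G' : vBounded V := ⟨G, hGm, M', fun x =>
    (hGM x).trans (mul_le_mul_of_nonneg_left (hUp x) hM'0)⟩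
  have hsG : ∀ N x, ‖(s N - G').1 x‖ ≤ M' * θ ^ N * V x := fun N x =>
    (hGs x N).trans (mul_le_mul_of_nonneg_left (hUp x) (by positivity))
  have hlim : Tendsto (fun N : ℕ => M' * θ ^ N) atTop (nhds 0) := by
    simpa using (tendsto_pow_atTop_nhds_zero_of_lt_one hθ0.le hθ1).const_mul M'
  refine ⟨G', M', hM'0, hGM, ?_, ?_, hG⟩
  · ext x
    have h1 : Tendsto (fun N => (markovOp h (s N)).1 x) atTop (nhds ((markovOp h G').1 x)) := by
      rw [tendsto_iff_norm_sub_tendsto_zero]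
      refine squeeze_zero (fun _ => norm_nonneg _) (fun N => ?_)
        (by simpa using (hlim.mul_const D).mul_const (V x))
      have := norm_markovOp_le h (by positivity) (hsG N) x
      rwa [map_sub] at this
    have h2 : ∀ N, (markovOp h (s N)).1 x = (s (N + 1)).1 x - F.1 x := fun N => by
      have : markovOp h (s N) = s (N + 1) - F := by
        simp only [s, map_sum, Finset.sum_range_succ' _ N, pow_zero, Module.End.one_apply,
          add_sub_cancel_right, pow_succ', Module.End.mul_apply]
      rw [this]
      rfl
    simp_rw [h2] at h1
    have h3 := ((hG x).comp (tendsto_add_atTop_nat 1)).sub_const (F.1 x)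
    have h4 := tendsto_nhds_unique h3 h1
    change G x = F.1 x + (markovOp h G').1 x
    rw [← h4]
    ring
  · have h1 : ∀ n, meanOp hν ((markovOp h ^ n) F) = 0 := by
      intro n
      induction n with
      | zero => simpa using hF0
      | succ n ih => rw [pow_succ', Module.End.mul_apply, H.meanOp_markovOp, ih]
    have h2 : ∀ N, meanOp hν (s N) = 0 := fun N => by simp [s, h1]
    have h3 : Tendsto (fun N => meanOp hν (s N - G')) atTop (nhds 0) :=
      squeeze_zero_norm (fun N => norm_meanOp_le hν (hsG N)) (by simpa using hlim.mul_const _)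
    simp_rw [map_sub, h2, zero_sub] at h3
    simpa using tendsto_nhds_unique tendsto_const_nhds h3

end Poisson

lemma norm_exp_ofReal_mul_I_sub_linear_le (s : ℝ) :
    ‖Complex.exp (s * Complex.I) - 1 - s * Complex.I‖ ≤ 3 * |s| ^ 2 := by
  have hn : ‖(s : ℂ) * Complex.I‖ = |s| := by simp
  rcases le_or_gt |s| 1 with hs | hs
  · have := Complex.norm_exp_sub_one_sub_id_le (x := s * Complex.I) (by rwa [hn])
    rw [hn] at this
    nlinarith [sq_nonneg |s|]
  · refine (norm_sub_le _ _).trans ?_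
    have := norm_exp_ofReal_mul_I_sub_one_le s
    rw [hn]
    nlinarith

lemma norm_exp_ofReal_mul_I_sub_quadratic_le (s : ℝ) :
    ‖Complex.exp (s * Complex.I) - 1 - s * Complex.I + s ^ 2 / 2‖ ≤ 4 * |s| ^ 3 := by
  have hn : ‖(s : ℂ) * Complex.I‖ = |s| := by simp
  rcases le_or_gt |s| 1 with hs | hs
  · have := Complex.exp_bound (x := s * Complex.I) (by rwa [hn]) (n := 3) (by norm_num)
    rw [hn] at this
    have e : Complex.exp (s * Complex.I) - 1 - s * Complex.I + s ^ 2 / 2 =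
        Complex.exp (s * Complex.I) -
          ∑ m ∈ Finset.range 3, ((s : ℂ) * Complex.I) ^ m / (m.factorial : ℂ) := by
      simp [Finset.sum_range_succ, Nat.factorial, mul_pow]
      ring
    rw [e]
    refine this.trans ?_
    norm_num [Nat.factorial]
    have : 0 ≤ |s| ^ 3 := by positivity
    linarith
  · refine (norm_add_le _ _).trans ?_
    have h2 := norm_exp_ofReal_mul_I_sub_linear_le s
    have : ‖(s : ℂ) ^ 2 / 2‖ = |s| ^ 2 / 2 := by simp
    rw [this]
    nlinarith [sq_nonneg |s|]

section Eigenfunction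

set_option linter.unusedSectionVars false

variable {E : Type*} [MeasurableSpace E] {Q : Kernel E E} [IsMarkovKernel Q] {V U : E → ℝ} {D : ℝ}
  {ν : Measure E} [IsProbabilityMeasure ν] {h : DriftBound Q V D} {hν : Integrable V ν} {C θ : ℝ}
  {ξ : E → ℝ} (hξ : Measurable ξ)

/-- The second-order approximate eigenfunction `1 + i t g - t² k`. -/
noncomputable def approxEigenfunction (h : DriftBound Q V D) (g k : vBounded V) (t : ℝ) :
    vBounded V :=
  h.one + ((t : ℂ) * Complex.I) • g - ((t : ℂ) ^ 2) • k

lemma GeomErgodic.exists_approxEigenfunction (H : GeomErgodic h hν C (θ ^ 3)) (hθ0 : 0 < θ)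
    (hθ1 : θ < 1) (hU : Measurable U) (hU1 : ∀ x, 1 ≤ U x) (hUV : ∀ x, U x ^ 3 = V x)
    {b : ℝ} (hb : ∀ x, |ξ x| ≤ b * U x) {G : vBounded V} {M s : ℝ} (hM : 0 ≤ M)
    (hGM : ∀ x, ‖G.1 x‖ ≤ M * U x) (hG0 : meanOp hν G = 0)
    (hG : ∀ x, G.1 x = ξ x + (markovOp h G).1 x)
    (hs : ∫ x, (G.1 x ^ 2 - (markovOp h G).1 x ^ 2) ∂ν = s) :
    ∃ (g k : vBounded V) (K : ℝ), 0 ≤ K ∧ (∀ x, ‖g.1 x‖ ≤ K * V x) ∧ (∀ x, ‖k.1 x‖ ≤ K * V x) ∧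
      meanOp hν g = 0 ∧ meanOp hν k = 0 ∧ ∀ t : ℝ, |t| ≤ 1 → ∀ x,
      ‖(twistedOp h hξ t (approxEigenfunction h g k t)).1 x -
        ((1 - s * t ^ 2 / 2 : ℝ) : ℂ) * (approxEigenfunction h g k t).1 x‖ ≤ K * |t| ^ 3 * V x := by
  rcases isEmpty_or_nonempty E with hE | hE
  · exact (NeZero.ne ν (Measure.eq_zero_of_isEmpty ν)).elim
  have hU0 : ∀ x, 0 < U x := fun x => zero_lt_one.trans_le (hU1 x)
  have hD := h.D_nonneg
  have hb0 : 0 ≤ b := nonneg_of_mul_nonneg_left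
    ((abs_nonneg _).trans (hb hE.some)) (hU0 hE.some)
  have hU2V : ∀ x, U x ^ 2 ≤ V x := fun x => by
    rw [← hUV]
    exact pow_le_pow_right₀ (hU1 x) (by omega)
  have hUU2 : ∀ x, U x ≤ U x ^ 2 := fun x => by nlinarith [hU1 x]
  have hUV' : ∀ x, U x ≤ V x := fun x => (hUU2 x).trans (hU2V x)
  set g := markovOp h G with hg
  have hgM : ∀ x, ‖g.1 x‖ ≤ (M + b) * U x := fun x => by
    have : g.1 x = G.1 x - ξ x := by rw [hG x]; ring
    rw [this, add_mul]
    refine (norm_sub_le _ _).trans (add_le_add (hGM x) ?_)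
    rw [Complex.norm_real]
    exact hb x
  have hgm := g.2.1
  set B := b ^ 2 / 2 + b * (M + b) + |s| / 2 with hB
  have hFB : ∀ x, ‖((ξ x : ℂ) ^ 2 / 2 + ξ x * g.1 x - s / 2)‖ ≤ B * U x ^ 2 := fun x => by
    refine (norm_sub_le _ _).trans ((add_le_add (norm_add_le _ _) le_rfl).trans ?_)
    simp only [norm_mul, norm_div, norm_pow, Complex.norm_real, Complex.norm_ofNat,
      Real.norm_eq_abs]
    have e1 : |ξ x| ^ 2 ≤ (b * U x) ^ 2 := pow_le_pow_left₀ (abs_nonneg _) (hb x) 2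
    have e2 : |ξ x| * ‖g.1 x‖ ≤ (b * U x) * ((M + b) * U x) :=
      mul_le_mul (hb x) (hgM x) (norm_nonneg _) (mul_nonneg hb0 (hU0 x).le)
    have e3 : |s| * 1 ≤ |s| * U x ^ 2 :=
      mul_le_mul_of_nonneg_left (one_le_pow₀ (hU1 x)) (abs_nonneg s)
    rw [hB]
    linarith
  have hB0 : 0 ≤ B := by positivity
  let F : vBounded V := ⟨fun x => (ξ x : ℂ) ^ 2 / 2 + ξ x * g.1 x - s / 2, by fun_prop, B,
    fun x => (hFB x).trans (mul_le_mul_of_nonneg_left (hU2V x) hB0)⟩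
  have hF0 : meanOp hν F = 0 := by
    have e1 : ∀ x, (G.1 x ^ 2 - g.1 x ^ 2) = 2 * F.1 x + s := fun x => by
      change _ = 2 * ((ξ x : ℂ) ^ 2 / 2 + ξ x * g.1 x - s / 2) + s
      rw [hG x]
      ring
    simp_rw [e1] at hs
    rw [integral_add ((integrable_of_vBounded hν F).const_mul 2) (integrable_const _),
      integral_const_mul] at hs
    change ∫ x, F.1 x ∂ν = 0
    simpa using hs
  obtain ⟨G₂, M₂, hM₂, hG₂M, hG₂, hG₂0, -⟩ :=
    H.exists_poisson hθ0 hθ1 hU hU1 hUV (p := 2) (q := 1) (by norm_num) (by norm_num) hB0 hFB hF0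
  set k := markovOp h G₂ with hk
  have hkM : ∀ x, ‖k.1 x‖ ≤ (M₂ + B) * U x ^ 2 := fun x => by
    have : k = G₂ - F := by rw [eq_sub_iff_add_eq, add_comm]; exact hG₂.symm
    rw [this, add_mul]
    exact (norm_sub_le _ _).trans (add_le_add (hG₂M x) (hFB x))
  have hG₂' : ∀ x, G₂.1 x = F.1 x + k.1 x := fun x => congrArg (fun f : vBounded V => f.1 x) hG₂
  set K₀ := 4 * b ^ 3 + 3 * (M + b) * b ^ 2 + (M₂ + B) * b with hK₀
  have hK₀0 : 0 ≤ K₀ := by positivity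
  have hgV : ∀ x, ‖g.1 x‖ ≤ (M + b) * V x := fun x =>
    (hgM x).trans (mul_le_mul_of_nonneg_left (hUV' x) (by positivity))
  have hkV : ∀ x, ‖k.1 x‖ ≤ (M₂ + B) * V x := fun x =>
    (hkM x).trans (mul_le_mul_of_nonneg_left (hU2V x) (by positivity))
  set K := K₀ * D + |s| / 2 * (M + b + (M₂ + B)) + (M + b) + (M₂ + B) with hK
  have hK0 : 0 ≤ K := by positivity
  have hsM : 0 ≤ |s| / 2 * (M + b + (M₂ + B)) := by positivity
  have hK₀D : 0 ≤ K₀ * D := by positivity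
  have hMb : 0 ≤ M + b := by positivity
  have hMB : 0 ≤ M₂ + B := by positivity
  refine ⟨g, k, K, hK0, fun x => (hgV x).trans ?_, fun x => (hkV x).trans ?_, ?_, ?_, ?_⟩
  · exact mul_le_mul_of_nonneg_right (by linarith) (h.pos x).le
  · exact mul_le_mul_of_nonneg_right (by linarith) (h.pos x).le
  · rw [hg, H.meanOp_markovOp, hG0]
  · rw [hk, H.meanOp_markovOp, hG₂0]
  intro t ht x
  set φ := approxEigenfunction h g k t with hφ
  have hφx : ∀ y, φ.1 y = 1 + t * Complex.I * g.1 y - t ^ 2 * k.1 y := fun y => rfl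
  let R : vBounded V := phaseOp V hξ t φ -
    (h.one + ((t : ℂ) * Complex.I) • G - ((t : ℂ) ^ 2) • G₂ - ((t : ℂ) ^ 2 * s / 2) • h.one)
  have hR : ∀ y, ‖R.1 y‖ ≤ K₀ * |t| ^ 3 * V y := fun y => by
    have e : R.1 y = (Complex.exp ((t * ξ y : ℝ) * Complex.I) - 1 - (t * ξ y : ℝ) * Complex.I
          + ((t * ξ y : ℝ) : ℂ) ^ 2 / 2)
        + t * Complex.I * g.1 y *
          (Complex.exp ((t * ξ y : ℝ) * Complex.I) - 1 - (t * ξ y : ℝ) * Complex.I)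
        - t ^ 2 * k.1 y * (Complex.exp ((t * ξ y : ℝ) * Complex.I) - 1) := by
      change Complex.exp (t * ξ y * Complex.I) * φ.1 y - (1 + (t * Complex.I) * G.1 y
        - t ^ 2 * G₂.1 y - t ^ 2 * s / 2 * 1) = _
      rw [hφx, hG y, hG₂' y]
      change _ - (_ - t ^ 2 * ((ξ y : ℂ) ^ 2 / 2 + ξ y * g.1 y - s / 2 + _) - _) = _
      push_cast
      linear_combination ((t : ℂ) ^ 2 * g.1 y * ξ y) * Complex.I_sq
    rw [e]
    refine (norm_sub_le _ _).trans ((add_le_add (norm_add_le _ _) le_rfl).trans ?_)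
    have hξt : |t * ξ y| ≤ |t| * (b * U y) := by
      rw [abs_mul]
      exact mul_le_mul_of_nonneg_left (hb y) (abs_nonneg t)
    have e1 := (norm_exp_ofReal_mul_I_sub_quadratic_le (t * ξ y)).trans
      (mul_le_mul_of_nonneg_left (pow_le_pow_left₀ (abs_nonneg _) hξt 3) (by norm_num))
    have e2 := (norm_exp_ofReal_mul_I_sub_linear_le (t * ξ y)).trans
      (mul_le_mul_of_nonneg_left (pow_le_pow_left₀ (abs_nonneg _) hξt 2) (by norm_num))
    have e3 := (norm_exp_ofReal_mul_I_sub_one_le (t * ξ y)).trans hξt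
    have e4 : ‖(t : ℂ) * Complex.I * g.1 y‖ ≤ |t| * ((M + b) * U y) := by
      rw [norm_mul, norm_mul, Complex.norm_I, mul_one, Complex.norm_real]
      exact mul_le_mul_of_nonneg_left (hgM y) (abs_nonneg t)
    have e5 : ‖(t : ℂ) ^ 2 * k.1 y‖ ≤ |t| ^ 2 * ((M₂ + B) * U y ^ 2) := by
      rw [norm_mul, norm_pow, Complex.norm_real]
      exact mul_le_mul_of_nonneg_left (hkM y) (by positivity)
    have hUy := (hU0 y).le
    have e6 := mul_le_mul e4 e2 (norm_nonneg _) (by positivity)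
    have e7 := mul_le_mul e5 e3 (norm_nonneg _) (by positivity)
    rw [norm_mul (_ * _) (_ - _ - _), norm_mul (_ * _) (_ - _)]
    refine (add_le_add (add_le_add e1 e6) e7).trans_eq ?_
    rw [hK₀, ← hUV y]
    ring
  have hPR := norm_markovOp_le h (by positivity) hR x
  have hL : (twistedOp h hξ t φ).1 x - ((1 - s * t ^ 2 / 2 : ℝ) : ℂ) * φ.1 x =
      (markovOp h R).1 x + s * t ^ 2 / 2 * (t * Complex.I * g.1 x - t ^ 2 * k.1 x) := by
    have e1 : twistedOp h hξ t φ = markovOp h R + (h.one + ((t : ℂ) * Complex.I) • g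
        - ((t : ℂ) ^ 2) • k - ((t : ℂ) ^ 2 * s / 2) • h.one) := by
      simp only [R, map_sub, map_add, map_smul, markovOp_one, ← hg, ← hk, twistedOp,
        Module.End.mul_apply]
      abel
    rw [e1]
    change (markovOp h R).1 x + (1 + (t * Complex.I) * g.1 x
        - t ^ 2 * k.1 x - t ^ 2 * s / 2 * 1) - _ = _
    rw [hφx]
    push_cast
    ring
  rw [hL]
  have ht3 : |t| ^ 2 * |t| ^ 2 ≤ |t| ^ 3 := by
    have : 0 ≤ |t| ^ 3 := by positivity
    nlinarith
  have e8 : ‖(s : ℂ) * t ^ 2 / 2 * (t * Complex.I * g.1 x - t ^ 2 * k.1 x)‖ ≤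
      |s| / 2 * (M + b + (M₂ + B)) * |t| ^ 3 * V x := by
    rw [norm_mul]
    have e9 : ‖(s : ℂ) * t ^ 2 / 2‖ = |s| * |t| ^ 2 / 2 := by simp
    have e10 : ‖(t : ℂ) * Complex.I * g.1 x - t ^ 2 * k.1 x‖ ≤
        |t| * ((M + b) * V x) + |t| ^ 2 * ((M₂ + B) * V x) := by
      refine (norm_sub_le _ _).trans (add_le_add ?_ ?_)
      · rw [norm_mul, norm_mul, Complex.norm_I, mul_one, Complex.norm_real]
        exact mul_le_mul_of_nonneg_left (hgV x) (abs_nonneg t)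
      · rw [norm_mul, norm_pow, Complex.norm_real]
        exact mul_le_mul_of_nonneg_left (hkV x) (by positivity)
    rw [e9]
    refine (mul_le_mul_of_nonneg_left e10 (by positivity)).trans ?_
    have := mul_le_mul_of_nonneg_left ht3 (mul_nonneg (by positivity : 0 ≤ |s| / 2)
      (mul_nonneg hMB (h.pos x).le))
    linarith
  refine (norm_add_le _ _).trans ((add_le_add hPR e8).trans ?_)
  have e11 : 0 ≤ (M + b + (M₂ + B)) * |t| ^ 3 * V x := by
    have := h.pos x
    positivity
  rw [hK]
  linarith

end Eigenfunction

section Decay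

set_option linter.unusedSectionVars false

variable {E : Type*} [MeasurableSpace E] {Q : Kernel E E} [IsMarkovKernel Q] {V : E → ℝ} {D : ℝ}
  {ν : Measure E} [IsProbabilityMeasure ν] {h : DriftBound Q V D} {hν : Integrable V ν} {C κ : ℝ}
  {ξ : E → ℝ} (hξ : Measurable ξ)

lemma vBounded_sub_apply (f g : vBounded V) (x : E) : (f - g).1 x = f.1 x - g.1 x := rfl

lemma vBounded_add_apply (f g : vBounded V) (x : E) : (f + g).1 x = f.1 x + g.1 x := rfl

lemma vBounded_smul_apply (c : ℂ) (f : vBounded V) (x : E) : (c • f).1 x = c * f.1 x := rfl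

lemma norm_approxEigenfunction_sub_one_le {g k : vBounded V} {K : ℝ} (hK : 0 ≤ K)
    (hg : ∀ x, ‖g.1 x‖ ≤ K * V x) (hk : ∀ x, ‖k.1 x‖ ≤ K * V x) {t : ℝ} (ht : |t| ≤ 1) (x : E) :
    ‖(approxEigenfunction h g k t).1 x - 1‖ ≤ 2 * K * |t| * V x := by
  have e : (approxEigenfunction h g k t).1 x - 1 = t * Complex.I * g.1 x - t ^ 2 * k.1 x := by
    change 1 + t * Complex.I * g.1 x - t ^ 2 * k.1 x - 1 = _
    ring
  rw [e]
  refine (norm_sub_le _ _).trans ?_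
  rw [norm_mul, norm_mul, norm_mul, norm_pow, Complex.norm_I, mul_one, Complex.norm_real,
    Real.norm_eq_abs]
  have h1 := mul_le_mul_of_nonneg_left (hg x) (abs_nonneg t)
  have h2 := mul_le_mul_of_nonneg_left (hk x) (by positivity : 0 ≤ |t| ^ 2)
  have h3 : |t| ^ 2 ≤ |t| := by nlinarith [abs_nonneg t]
  have h4 := mul_le_mul_of_nonneg_right h3 (mul_nonneg hK (h.pos x).le)
  linarith

lemma meanOp_approxEigenfunction {g k : vBounded V} (hg : meanOp hν g = 0)
    (hk : meanOp hν k = 0) (t : ℝ) : meanOp hν (approxEigenfunction h g k t) = 1 := by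
  have : meanOp hν h.one = 1 := by
    change ∫ _, (1 : ℂ) ∂ν = 1
    simp
  simp [approxEigenfunction, hg, hk, this]

lemma GeomErgodic.norm_twistedOp_pow_sub_pow_mul_le (H : GeomErgodic h hν C κ) {K l t : ℝ}
    (hK : 0 ≤ K) (hl0 : 0 ≤ l) (hl1 : l ≤ 1) {φ : vBounded V}
    (hφ : ∀ x, ‖(twistedOp h hξ t φ).1 x - (l : ℂ) * φ.1 x‖ ≤ K * V x) (m : ℕ) (x : E) :
    ‖((twistedOp h hξ t ^ m) φ - ((l : ℂ) ^ m) • φ).1 x‖ ≤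
      m * (K * ((∫ x, V x ∂ν) + C)) * V x := by
  induction m with
  | zero => simp
  | succ m ih =>
    have e1 : (twistedOp h hξ t ^ (m + 1)) φ - ((l : ℂ) ^ (m + 1)) • φ =
        (twistedOp h hξ t ^ m) (twistedOp h hξ t φ - (l : ℂ) • φ) +
        (l : ℂ) • ((twistedOp h hξ t ^ m) φ - ((l : ℂ) ^ m) • φ) := by
      rw [map_sub, map_smul, smul_sub, smul_smul, pow_succ, Module.End.mul_apply, pow_succ']
      abel
    have e2 := H.norm_twistedOp_pow_le' hξ t (f := twistedOp h hξ t φ - (l : ℂ) • φ) hK hφ m x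
    rw [e1, vBounded_add_apply, vBounded_smul_apply]
    refine (norm_add_le _ _).trans ?_
    rw [norm_mul, Complex.norm_real, Real.norm_of_nonneg hl0]
    have e3 : l * ‖((twistedOp h hξ t ^ m) φ - ((l : ℂ) ^ m) • φ).1 x‖ ≤
        m * (K * ((∫ x, V x ∂ν) + C)) * V x :=
      (mul_le_of_le_one_left (norm_nonneg _) hl1).trans ih
    rw [Nat.cast_succ]
    linarith

/-- Gaussian-type decay of the powers of the twisted operator for small frequencies. -/
lemma GeomErgodic.exists_norm_twistedOp_pow_le_exp (H : GeomErgodic h hν C κ) {b : ℝ}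
    (hb : ∀ x, |ξ x| ≤ b * V x) {g k : vBounded V} {K s : ℝ} (hs : 0 < s) (hK : 0 ≤ K)
    (hgK : ∀ x, ‖g.1 x‖ ≤ K * V x) (hkK : ∀ x, ‖k.1 x‖ ≤ K * V x) (hg0 : meanOp hν g = 0)
    (hk0 : meanOp hν k = 0)
    (hφ : ∀ t : ℝ, |t| ≤ 1 → ∀ x, ‖(twistedOp h hξ t (approxEigenfunction h g k t)).1 x -
      ((1 - s * t ^ 2 / 2 : ℝ) : ℂ) * (approxEigenfunction h g k t).1 x‖ ≤ K * |t| ^ 3 * V x) :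
    ∃ α A c₁ : ℝ, 0 < α ∧ α ≤ 1 ∧ s * α ^ 2 ≤ 1 ∧ 0 ≤ A ∧ 0 < c₁ ∧ ∀ t : ℝ, |t| ≤ α →
      ∀ (f : vBounded V) (M : ℝ), 0 ≤ M → (∀ x, ‖f.1 x‖ ≤ M * V x) → ∀ (n : ℕ) x,
      ‖((twistedOp h hξ t ^ n) f).1 x‖ ≤ A * M * Real.exp (-c₁ * n * t ^ 2) * V x := by
  have hC := H.C_nonneg
  have hN := one_le_integral_weight h hν
  obtain ⟨β, hβ, hβN, m, hm1, α₁, hα₁, hT⟩ :=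
    H.exists_norm_twistedOp_pow_sub_meanOp_le hξ hb (ε := 1 / 10) (by norm_num)
  set N := ∫ x, V x ∂ν with hNdef
  have hm0 : (0 : ℝ) < m := by exact_mod_cast hm1
  set A₁ := m * (K * (N + C)) * (1 / β + N) with hA₁
  have hA₁0 : 0 ≤ A₁ := by positivity
  obtain ⟨α, hα, hαα₁, hα1, hsα, hKα, hAα⟩ : ∃ α : ℝ, 0 < α ∧ α ≤ α₁ ∧ α ≤ 1 ∧ s * α ≤ 1 ∧
      2 * K * α ≤ β ∧ 8 * A₁ * α ≤ s := by
    refine ⟨min (min α₁ 1) (min (1 / s) (min (β / (2 * K + 1)) (s / (8 * A₁ + 1)))),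
      by positivity, (min_le_left _ _).trans (min_le_left _ _),
      (min_le_left _ _).trans (min_le_right _ _), ?_, ?_, ?_⟩
    · refine (mul_le_mul_of_nonneg_left ((min_le_right _ _).trans (min_le_left _ _)) hs.le).trans ?_
      rw [mul_one_div_cancel hs.ne']
    · refine (mul_le_mul_of_nonneg_left ((min_le_right _ _).trans ((min_le_right _ _).trans
        (min_le_left _ _))) (by positivity : 0 ≤ 2 * K)).trans ?_
      rw [mul_div_assoc', div_le_iff₀ (by positivity)]
      nlinarith
    · refine (mul_le_mul_of_nonneg_left ((min_le_right _ _).trans ((min_le_right _ _).trans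
        (min_le_right _ _))) (by positivity : 0 ≤ 8 * A₁)).trans ?_
      rw [mul_div_assoc', div_le_iff₀ (by positivity)]
      nlinarith
  refine ⟨α, Real.exp 1 * ((N + C) * (1 / β + 2 * N) * (1 + β)), s / 4 / m, hα, hα1, ?_,
    by positivity, by positivity, ?_⟩
  · have : α ^ 2 ≤ α := by nlinarith
    nlinarith
  intro t ht f M hM hf n x
  have ht1 : |t| ≤ 1 := ht.trans hα1
  have ht2 : t ^ 2 = |t| ^ 2 := (sq_abs t).symm
  have hst : s * t ^ 2 ≤ 1 := by
    have : |t| ^ 2 ≤ α := by nlinarith [abs_nonneg t]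
    rw [ht2]
    nlinarith
  have hst0 : 0 ≤ s * t ^ 2 := by positivity
  set φ := approxEigenfunction h g k t with hφdef
  set l : ℝ := 1 - s * t ^ 2 / 2 with hl
  set T := twistedOp h hξ t ^ m with hTdef
  have hφ1 : meanOp hν φ = 1 := meanOp_approxEigenfunction hg0 hk0 t
  have hVpos := h.pos
  have hφW : ∀ x, ‖φ.1 x‖ ≤ 1 + β * V x := fun x => by
    have e1 := norm_approxEigenfunction_sub_one_le (h := h) hK hgK hkK ht1 x
    have e2 : ‖φ.1 x‖ ≤ ‖φ.1 x - 1‖ + 1 := by simpa using norm_add_le (φ.1 x - 1) 1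
    have e3 : 2 * K * |t| ≤ β :=
      (mul_le_mul_of_nonneg_left ht (by positivity : 0 ≤ 2 * K)).trans hKα
    have e4 := mul_le_mul_of_nonneg_right e3 (hVpos x).le
    linarith
  have hρ : ∀ x, ‖(T φ - ((l : ℂ) ^ m) • φ).1 x‖ ≤ m * (K * |t| ^ 3 * (N + C)) * V x :=
    H.norm_twistedOp_pow_sub_pow_mul_le hξ (by positivity) (by linarith) (by linarith)
      (hφ t ht1) m
  set ρ := T φ - ((l : ℂ) ^ m) • φ with hρdef
  set δ₀ := m * (K * |t| ^ 3 * (N + C)) with hδ₀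
  have hδ₀0 : 0 ≤ δ₀ := by positivity
  have hδ : 2 * (δ₀ * (1 / β + N)) ≤ s * t ^ 2 / 4 := by
    have e1 : δ₀ * (1 / β + N) = A₁ * |t| * t ^ 2 := by rw [hδ₀, hA₁, ht2]; ring
    have e2 : 8 * A₁ * |t| ≤ s := (mul_le_mul_of_nonneg_left ht (by positivity)).trans hAα
    have e3 := mul_le_mul_of_nonneg_right e2 (sq_nonneg t)
    rw [e1]
    linarith
  have hρν : ‖meanOp hν ρ‖ ≤ δ₀ * N := norm_meanOp_le hν hρ
  have hVW : ∀ x, V x ≤ 1 / β * (1 + β * V x) := fun x => by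
    rw [mul_add, ← mul_assoc, one_div_mul_cancel hβ.ne', one_mul, mul_one]
    have : 0 < 1 / β := by positivity
    linarith
  have hstep : ∀ (f : vBounded V) (y : ℝ), 0 ≤ y →
      (∀ x, ‖(f - meanOp hν f • φ).1 x‖ ≤ y * (1 + β * V x)) →
      ∃ y' : ℝ, 0 ≤ y' ∧ (∀ x, ‖(T f - meanOp hν (T f) • φ).1 x‖ ≤ y' * (1 + β * V x)) ∧
        ‖meanOp hν (T f)‖ + y' ≤ (1 - s * t ^ 2 / 4) * (‖meanOp hν f‖ + y) := by
    intro f y hy hf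
    set a := meanOp hν f with ha
    set r := f - a • φ with hr
    have hr0 : meanOp hν r = 0 := by simp [r, hφ1, ← ha]
    have hTr : ∀ x, ‖(T r).1 x‖ ≤ 1 / 10 * y * (1 + β * V x) := by
      simpa [hr0] using hT t (ht.trans hαα₁) r y hy hf
    have hTrν : ‖meanOp hν (T r)‖ ≤ 1 / 10 * y * 2 := by
      refine (norm_integral_le_of_norm_le (((integrable_const (1 : ℝ)).add
        (hν.const_mul β)).const_mul (1 / 10 * y)) (ae_of_all _ hTr)).trans ?_
      rw [integral_const_mul]
      refine mul_le_mul_of_nonneg_left ?_ (by positivity)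
      simp only [Pi.add_apply]
      rw [integral_add (integrable_const _) (hν.const_mul β), integral_const_mul, ← hNdef]
      simp only [integral_const, probReal_univ, one_smul]
      linarith
    have hTf : T f = a • ((l : ℂ) ^ m • φ + ρ) + T r := by
      rw [hρdef, add_sub_cancel, ← map_smul, ← map_add, hr, add_sub_cancel]
    have hTfν : meanOp hν (T f) = a * ((l : ℂ) ^ m + meanOp hν ρ) + meanOp hν (T r) := by
      rw [hTf]
      simp [hφ1, mul_add]
    have hr' : T f - meanOp hν (T f) • φ =
        a • ρ + T r - (a * meanOp hν ρ + meanOp hν (T r)) • φ := by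
      rw [hTfν, hTf]
      module
    have ha' : ‖a * meanOp hν ρ‖ ≤ ‖a‖ * (δ₀ * N) := by
      rw [norm_mul]
      exact mul_le_mul_of_nonneg_left hρν (norm_nonneg a)
    refine ⟨‖a‖ * (δ₀ * (1 / β + N)) + 3 / 10 * y, by positivity, fun x => ?_, ?_⟩
    · have hW : 0 ≤ 1 + β * V x := by have := hVpos x; positivity
      rw [hr', vBounded_sub_apply, vBounded_add_apply, vBounded_smul_apply, vBounded_smul_apply]
      refine (norm_sub_le _ _).trans ((add_le_add (norm_add_le _ _) le_rfl).trans ?_)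
      rw [norm_mul, norm_mul]
      have e1 : ‖a‖ * ‖ρ.1 x‖ ≤ ‖a‖ * (δ₀ * (1 / β * (1 + β * V x))) := by
        gcongr
        exact (hρ x).trans (mul_le_mul_of_nonneg_left (hVW x) hδ₀0)
      have e2 : ‖a * meanOp hν ρ + meanOp hν (T r)‖ * ‖φ.1 x‖ ≤
          (‖a‖ * (δ₀ * N) + 1 / 10 * y * 2) * (1 + β * V x) :=
        mul_le_mul ((norm_add_le _ _).trans (add_le_add ha' hTrν)) (hφW x) (norm_nonneg _)
          (by positivity)
      refine (add_le_add (add_le_add e1 (hTr x)) e2).trans_eq ?_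
      ring
    · have e1 : ‖meanOp hν (T f)‖ ≤ ‖a‖ * l + ‖a‖ * (δ₀ * (1 / β + N)) + 1 / 10 * y * 2 := by
        rw [hTfν, mul_add]
        refine (norm_add_le _ _).trans (add_le_add ((norm_add_le _ _).trans
          (add_le_add ?_ (ha'.trans ?_))) hTrν)
        · rw [norm_mul, norm_pow, Complex.norm_real, Real.norm_of_nonneg (by linarith)]
          exact mul_le_mul_of_nonneg_left
            (pow_le_of_le_one (by linarith) (by linarith) (by omega)) (norm_nonneg a)
        · have : 0 < 1 / β := by positivity
          gcongr
          linarith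
      have e2 := mul_le_mul_of_nonneg_left hδ (norm_nonneg a)
      have e3 := mul_le_mul_of_nonneg_right hst hy
      rw [hl] at e1
      linarith
  have hiter : ∀ (f : vBounded V) (M : ℝ), 0 ≤ M → (∀ x, ‖f.1 x‖ ≤ M * V x) → ∀ (q : ℕ),
      ∃ y : ℝ, 0 ≤ y ∧
        (∀ x, ‖((T ^ q) f - meanOp hν ((T ^ q) f) • φ).1 x‖ ≤ y * (1 + β * V x)) ∧
        ‖meanOp hν ((T ^ q) f)‖ + y ≤ (1 - s * t ^ 2 / 4) ^ q * (M * (1 / β + 2 * N)) := by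
    intro f M hM hf q
    induction q with
    | zero =>
      have e1 := norm_meanOp_le hν hf
      rw [← hNdef] at e1
      refine ⟨M * (1 / β + N), by positivity, fun x => ?_, ?_⟩
      · rw [pow_zero, Module.End.one_apply, vBounded_sub_apply, vBounded_smul_apply]
        refine (norm_sub_le _ _).trans ?_
        rw [norm_mul]
        have e2 := (hf x).trans (mul_le_mul_of_nonneg_left (hVW x) hM)
        have e3 := mul_le_mul e1 (hφW x) (norm_nonneg _) (by positivity)
        refine (add_le_add e2 e3).trans_eq ?_
        ring
      · rw [pow_zero, pow_zero, Module.End.one_apply]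
        linarith
    | succ q ih =>
      obtain ⟨y, hy, h1, h2⟩ := ih
      obtain ⟨y', hy', h1', h2'⟩ := hstep _ y hy h1
      rw [← Module.End.mul_apply, ← pow_succ'] at h1' h2'
      refine ⟨y', hy', h1', h2'.trans ?_⟩
      rw [pow_succ' (1 - s * t ^ 2 / 4), mul_assoc]
      exact mul_le_mul_of_nonneg_left h2 (by linarith)
  have hfr := H.norm_twistedOp_pow_le' hξ t hM hf (n % m)
  rw [← hNdef] at hfr
  obtain ⟨y, hy, h1, h2⟩ := hiter ((twistedOp h hξ t ^ (n % m)) f) (M * (N + C))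
    (by positivity) hfr (n / m)
  have hn : (twistedOp h hξ t ^ n) f = (T ^ (n / m)) ((twistedOp h hξ t ^ (n % m)) f) := by
    rw [hTdef, ← pow_mul, ← Module.End.mul_apply, ← pow_add, Nat.div_add_mod]
  set F := (T ^ (n / m)) ((twistedOp h hξ t ^ (n % m)) f) with hF
  have hW : 0 ≤ 1 + β * V x := by have := hVpos x; positivity
  have hFx : ‖F.1 x‖ ≤ (‖meanOp hν F‖ + y) * (1 + β * V x) := by
    have e1 : F.1 x = (F - meanOp hν F • φ).1 x + meanOp hν F * φ.1 x := by
      rw [vBounded_sub_apply, vBounded_smul_apply]; ring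
    rw [e1]
    refine (norm_add_le _ _).trans ?_
    rw [norm_mul, add_mul, add_comm]
    exact add_le_add (mul_le_mul_of_nonneg_left (hφW x) (norm_nonneg _)) (h1 x)
  have hexp : (1 - s * t ^ 2 / 4) ^ (n / m) ≤ Real.exp 1 * Real.exp (-(s / 4 / m) * n * t ^ 2) := by
    have e1 : 1 - s * t ^ 2 / 4 ≤ Real.exp (-(s * t ^ 2 / 4)) := by
      have := Real.add_one_le_exp (-(s * t ^ 2 / 4))
      linarith
    refine (pow_le_pow_left₀ (by linarith) e1 _).trans ?_
    rw [← Real.exp_nat_mul, ← Real.exp_add]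
    refine Real.exp_le_exp.2 ?_
    have e2 : (n : ℝ) ≤ (n / m : ℕ) * m + m := by
      have := Nat.div_add_mod n m
      have h3 := Nat.mod_lt n hm1
      have : n ≤ (n / m) * m + m := by rw [mul_comm]; omega
      exact_mod_cast this
    have e3 : (n : ℝ) / m ≤ (n / m : ℕ) + 1 := by
      rw [div_le_iff₀ hm0]; linarith
    have e4 := mul_le_mul_of_nonneg_left e3 (by positivity : 0 ≤ s * t ^ 2 / 4)
    have e5 : s / 4 / m * n * t ^ 2 = s * t ^ 2 / 4 * (n / m) := by ring
    rw [neg_mul, neg_mul, e5]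
    linarith
  rw [hn]
  refine hFx.trans ((mul_le_mul_of_nonneg_right (h2.trans
    (mul_le_mul_of_nonneg_right hexp (by positivity))) hW).trans ?_)
  have hWV : 1 + β * V x ≤ (1 + β) * V x := by linarith [h.one_le x]
  refine (mul_le_mul_of_nonneg_left hWV (by positivity)).trans_eq ?_
  ring

end Decay

section Gaussian

set_option linter.unusedSectionVars false

variable {E : Type*} [MeasurableSpace E] {Q : Kernel E E} [IsMarkovKernel Q] {V : E → ℝ} {D : ℝ}
  {ν : Measure E} [IsProbabilityMeasure ν] {h : DriftBound Q V D} {hν : Integrable V ν} {C κ : ℝ}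
  {ξ : E → ℝ} (hξ : Measurable ξ)

/-- The powers of the twisted operator applied to `1` are close to a Gaussian factor. -/
lemma GeomErgodic.exists_norm_twistedOp_pow_one_sub_le (H : GeomErgodic h hν C κ) {b : ℝ}
    (hb : ∀ x, |ξ x| ≤ b * V x) {g k : vBounded V} {K s : ℝ} (hs : 0 < s) (hK : 0 ≤ K)
    (hgK : ∀ x, ‖g.1 x‖ ≤ K * V x) (hkK : ∀ x, ‖k.1 x‖ ≤ K * V x) (hg0 : meanOp hν g = 0)
    (hk0 : meanOp hν k = 0)
    (hφ : ∀ t : ℝ, |t| ≤ 1 → ∀ x, ‖(twistedOp h hξ t (approxEigenfunction h g k t)).1 x -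
      ((1 - s * t ^ 2 / 2 : ℝ) : ℂ) * (approxEigenfunction h g k t).1 x‖ ≤ K * |t| ^ 3 * V x) :
    ∃ α B c₂ : ℝ, 0 < α ∧ 0 ≤ B ∧ 0 < c₂ ∧ ∀ t : ℝ, |t| ≤ α → ∀ (n : ℕ) x,
      ‖((twistedOp h hξ t ^ n) h.one).1 x - (Real.exp (-(n * (s * t ^ 2 / 2))) : ℝ)‖ ≤
        B * |t| * Real.exp (-c₂ * n * t ^ 2) * V x := by
  obtain ⟨α, A, c₁, hα, hα1, hsα, hA, hc₁, hL⟩ :=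
    H.exists_norm_twistedOp_pow_le_exp hξ hb hs hK hgK hkK hg0 hk0 hφ
  obtain ⟨c, hc, hcc₁, hcs⟩ : ∃ c : ℝ, 0 < c ∧ c ≤ c₁ ∧ c ≤ s / 2 :=
    ⟨min c₁ (s / 2), by positivity, min_le_left _ _, min_le_right _ _⟩
  set Y := K * A * Real.exp c + s ^ 2 * Real.exp c with hY
  refine ⟨α, 2 * K * A + 2 * K + Y * (2 / c), c / 2, hα, by positivity, by positivity,
    fun t ht n x => ?_⟩
  have ht1 : |t| ≤ 1 := ht.trans hα1
  have ht2 : t ^ 2 = |t| ^ 2 := (sq_abs t).symm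
  have ht2' : t ^ 2 ≤ 1 := by rw [ht2]; exact pow_le_one₀ (abs_nonneg t) ht1
  have hst : s * t ^ 2 ≤ 1 := by
    refine le_trans (mul_le_mul_of_nonneg_left ?_ hs.le) hsα
    rw [ht2]
    exact pow_le_pow_left₀ (abs_nonneg t) ht 2
  have hst0 : 0 ≤ s * t ^ 2 := by positivity
  have hVpos := h.pos
  set φ := approxEigenfunction h g k t with hφdef
  set l : ℝ := 1 - s * t ^ 2 / 2 with hl
  have hl0 : 0 ≤ l := by linarith
  set e := Real.exp (-c * t ^ 2) with he
  have he0 : 0 < e := Real.exp_pos _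
  have hen : ∀ n : ℕ, Real.exp (-c * n * t ^ 2) = e ^ n := fun n => by
    rw [he, ← Real.exp_nat_mul]; ring_nf
  have hee : Real.exp (c * t ^ 2) * e = 1 := by
    rw [he, ← Real.exp_add]; ring_nf; exact Real.exp_zero
  have hec : Real.exp (c * t ^ 2) ≤ Real.exp c := Real.exp_le_exp.2 (by nlinarith)
  have hμe : Real.exp (-(s * t ^ 2 / 2)) ≤ e := Real.exp_le_exp.2 (by nlinarith)
  have hlμ : l ≤ Real.exp (-(s * t ^ 2 / 2)) := by
    have := Real.add_one_le_exp (-(s * t ^ 2 / 2))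
    linarith
  have hle : l ≤ e := hlμ.trans hμe
  set μ := Real.exp (-(s * t ^ 2 / 2)) with hμ
  have hμ0 : 0 < μ := Real.exp_pos _
  have hL' : ∀ (f : vBounded V) (M : ℝ), 0 ≤ M → (∀ x, ‖f.1 x‖ ≤ M * V x) → ∀ (n : ℕ) x,
      ‖((twistedOp h hξ t ^ n) f).1 x‖ ≤ A * M * e ^ n * V x := fun f M hM hf n x => by
    refine (hL t ht f M hM hf n x).trans ?_
    rw [← hen]
    have : -c₁ * n * t ^ 2 ≤ -c * n * t ^ 2 := by
      have : 0 ≤ (n : ℝ) * t ^ 2 := by positivity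
      nlinarith
    have h1 := hVpos x
    gcongr
  have hE : ∀ (n : ℕ) x, ‖((twistedOp h hξ t ^ n) φ).1 x - (l : ℂ) ^ n * φ.1 x‖ ≤
      n * (K * A * |t| ^ 3 * Real.exp (c * t ^ 2)) * e ^ n * V x := by
    intro n x
    induction n with
    | zero => simp
    | succ n ih =>
      have e1 : (twistedOp h hξ t ^ (n + 1)) φ =
          (twistedOp h hξ t ^ n) (twistedOp h hξ t φ - (l : ℂ) • φ) +
          (l : ℂ) • (twistedOp h hξ t ^ n) φ := by
        rw [map_sub, map_smul, pow_succ, Module.End.mul_apply]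
        abel
      have e2 := hL' (twistedOp h hξ t φ - (l : ℂ) • φ) (K * |t| ^ 3) (by positivity)
        (hφ t ht1) n x
      rw [e1, vBounded_add_apply, vBounded_smul_apply, pow_succ', mul_assoc, add_sub_assoc,
        ← mul_sub]
      refine (norm_add_le _ _).trans ?_
      rw [norm_mul, Complex.norm_real, Real.norm_of_nonneg hl0]
      have e3 := mul_le_mul hle ih (norm_nonneg _) he0.le
      refine (add_le_add e2 e3).trans_eq ?_
      rw [Nat.cast_succ, pow_succ]
      linear_combination (-(K * A * |t| ^ 3 * e ^ n * V x)) * hee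
  have ht3 : (s * t ^ 2 / 2) ^ 2 ≤ s ^ 2 * |t| ^ 3 := by
    have e1 : |t| ^ 4 ≤ |t| ^ 3 := pow_le_pow_of_le_one (abs_nonneg t) ht1 (by norm_num)
    have e2 := mul_le_mul_of_nonneg_left e1 (sq_nonneg s)
    have e3 : 0 ≤ s ^ 2 * |t| ^ 3 := by positivity
    have e4 : (s * t ^ 2 / 2) ^ 2 = s ^ 2 * |t| ^ 4 / 4 := by rw [ht2]; ring
    linarith
  have hμl : |μ - l| ≤ s ^ 2 * |t| ^ 3 := by
    have e1 : |-(s * t ^ 2 / 2)| ≤ 1 := by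
      rw [abs_neg, abs_of_nonneg (by positivity)]; linarith
    have := Real.norm_exp_sub_one_sub_id_le (x := -(s * t ^ 2 / 2)) e1
    rw [Real.norm_eq_abs, Real.norm_eq_abs, sq_abs, neg_sq] at this
    have e2 : μ - l = Real.exp (-(s * t ^ 2 / 2)) - 1 - -(s * t ^ 2 / 2) := by
      rw [hl, hμ]; ring
    rw [e2]
    exact this.trans ht3
  have hμn : ∀ n : ℕ, |μ ^ n - l ^ n| ≤
      n * (s ^ 2 * |t| ^ 3 * Real.exp (c * t ^ 2)) * e ^ n := by
    intro n
    induction n with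
    | zero => simp
    | succ n ih =>
      have e1 : μ ^ (n + 1) - l ^ (n + 1) = μ ^ n * (μ - l) + l * (μ ^ n - l ^ n) := by ring
      rw [e1]
      refine (abs_add_le _ _).trans ?_
      rw [abs_mul, abs_mul, abs_of_nonneg hl0, abs_of_pos (pow_pos hμ0 n)]
      have e2 := mul_le_mul (pow_le_pow_left₀ hμ0.le hμe n) hμl (abs_nonneg _) (by positivity)
      have e3 := mul_le_mul hle ih (abs_nonneg _) he0.le
      refine (add_le_add e2 e3).trans_eq ?_
      rw [Nat.cast_succ, pow_succ]
      linear_combination (-(s ^ 2 * |t| ^ 3 * e ^ n)) * hee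
  have hφ1 := norm_approxEigenfunction_sub_one_le (h := h) hK hgK hkK ht1
  have g1 := hL' (φ - h.one) (2 * K * |t|) (by positivity) hφ1 n x
  have g2 := hE n x
  have g3 : ‖(l : ℂ) ^ n * (φ.1 x - 1)‖ ≤ e ^ n * (2 * K * |t| * V x) := by
    rw [norm_mul, norm_pow, Complex.norm_real, Real.norm_of_nonneg hl0]
    exact mul_le_mul (pow_le_pow_left₀ hl0 hle n) (hφ1 x) (norm_nonneg _) (by positivity)
  have g4 : ‖(μ : ℂ) ^ n - (l : ℂ) ^ n‖ ≤
      n * (s ^ 2 * |t| ^ 3 * Real.exp (c * t ^ 2)) * e ^ n * V x := by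
    rw [← Complex.ofReal_pow, ← Complex.ofReal_pow, ← Complex.ofReal_sub, Complex.norm_real]
    exact (hμn n).trans (le_mul_of_one_le_right (by positivity) (h.one_le x))
  have key : ((twistedOp h hξ t ^ n) h.one).1 x - (Real.exp (-(n * (s * t ^ 2 / 2))) : ℝ) =
      -((twistedOp h hξ t ^ n) (φ - h.one)).1 x +
        (((twistedOp h hξ t ^ n) φ).1 x - (l : ℂ) ^ n * φ.1 x) +
        (l : ℂ) ^ n * (φ.1 x - 1) - ((μ : ℂ) ^ n - (l : ℂ) ^ n) := by
    have : Real.exp (-(n * (s * t ^ 2 / 2))) = μ ^ n := by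
      rw [hμ, ← Real.exp_nat_mul]; ring_nf
    rw [map_sub, vBounded_sub_apply, this]
    push_cast
    ring
  rw [key]
  refine (norm_sub_le _ _).trans ((add_le_add norm_add₃_le le_rfl).trans ?_)
  rw [norm_neg]
  refine (add_le_add (add_le_add (add_le_add g1 g2) g3) g4).trans ?_
  set d := Real.exp (-(c / 2) * n * t ^ 2) with hd
  have hd0 : 0 < d := Real.exp_pos _
  have hdd : e ^ n = d * d := by
    rw [← hen, hd, ← Real.exp_add]; ring_nf
  have hd1 : d ≤ 1 := Real.exp_le_one_iff.2 (by
    have : 0 ≤ c / 2 * (n * t ^ 2) := by positivity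
    linarith)
  have hnd : n * t ^ 2 * d ≤ 2 / c := by
    have e1 := Real.add_one_le_exp (c / 2 * n * t ^ 2)
    have e2 : Real.exp (c / 2 * n * t ^ 2) * d = 1 := by
      rw [hd, ← Real.exp_add]; ring_nf; exact Real.exp_zero
    rw [le_div_iff₀ hc]
    have e3 := mul_le_mul_of_nonneg_right e1 hd0.le
    rw [e2] at e3
    linarith
  have hVx := (hVpos x).le
  have k1 : d * d ≤ d := mul_le_of_le_one_left hd0.le hd1
  have k2 : n * |t| ^ 3 * (d * d) ≤ 2 / c * |t| * d := by
    have : n * |t| ^ 3 * (d * d) = (n * t ^ 2 * d) * (|t| * d) := by rw [ht2]; ring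
    rw [this, mul_assoc (2 / c)]
    exact mul_le_mul_of_nonneg_right hnd (by positivity)
  have k3 : n * (K * A * |t| ^ 3 * Real.exp (c * t ^ 2)) * (d * d) * V x +
      n * (s ^ 2 * |t| ^ 3 * Real.exp (c * t ^ 2)) * (d * d) * V x ≤
      Y * (2 / c) * |t| * d * V x := by
    calc _ = (K * A * Real.exp (c * t ^ 2) + s ^ 2 * Real.exp (c * t ^ 2)) *
          (n * |t| ^ 3 * (d * d)) * V x := by ring
      _ ≤ Y * (2 / c * |t| * d) * V x := by
          rw [hY]
          gcongr
      _ = _ := by ring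
  have k4 : A * (2 * K * |t|) * (d * d) * V x ≤ A * (2 * K * |t|) * d * V x := by gcongr
  have k5 : d * d * (2 * K * |t| * V x) ≤ d * (2 * K * |t| * V x) := by gcongr
  rw [hdd]
  linarith

end Gaussian

section Drift

variable {E : Type*} [MeasurableSpace E] {Q : Kernel E E} [IsMarkovKernel Q] {V : E → ℝ}
  {ν : Measure E}

lemma driftBound_of_norm_integral_sub_le (hVm : Measurable V) (hV1 : ∀ x, 1 ≤ V x)
    (hν : Integrable V ν) {A : ℝ} (hA : ∀ f : E → ℂ, Measurable f → (∀ x, ‖f x‖ ≤ V x) →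
      ∀ x, ‖∫ y, f y ∂(Q x) - ∫ y, f y ∂ν‖ ≤ A * V x) :
    DriftBound Q V ((∫ x, V x ∂ν) + A) := by
  have hV0 : ∀ x, 0 ≤ V x := fun x => zero_le_one.trans (hV1 x)
  have hN0 : 0 ≤ ∫ x, V x ∂ν := integral_nonneg hV0
  have hmin0 : ∀ (k : ℕ) x, 0 ≤ min (V x) k := fun k x => le_min (hV0 x) k.cast_nonneg
  have hmeas : ∀ k : ℕ, Measurable fun x => min (V x) k := fun k => hVm.min measurable_const
  have hint : ∀ (k : ℕ) x, ∫ y, min (V y) k ∂(Q x) ≤ ((∫ x, V x ∂ν) + A) * V x := by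
    intro k x
    have h1 := hA (fun y => ((min (V y) k : ℝ) : ℂ)) (Complex.measurable_ofReal.comp (hmeas k))
      (fun y => by
        rw [Complex.norm_real, Real.norm_of_nonneg (hmin0 k y)]
        exact min_le_left _ _) x
    rw [integral_complex_ofReal, integral_complex_ofReal, ← Complex.ofReal_sub,
      Complex.norm_real] at h1
    have h2 := (le_abs_self _).trans h1
    have h3 : ∫ y, min (V y) k ∂ν ≤ ∫ y, V y ∂ν :=
      integral_mono_of_nonneg (ae_of_all _ (hmin0 k)) hν (ae_of_all _ fun y => min_le_left _ _)
    have h4 := mul_le_mul_of_nonneg_left (hV1 x) hN0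
    linarith
  have hlint : ∀ x, ∫⁻ y, ENNReal.ofReal (V y) ∂(Q x) ≤
      ENNReal.ofReal (((∫ x, V x ∂ν) + A) * V x) := by
    intro x
    refine le_of_tendsto' (lintegral_tendsto_of_tendsto_of_monotone
      (f := fun (k : ℕ) y => ENNReal.ofReal (min (V y) k))
      (fun k => (hmeas k).ennreal_ofReal.aemeasurable) (ae_of_all _ fun y i j hij => ?_)
      (ae_of_all _ fun y => ?_)) fun k => ?_
    · exact ENNReal.ofReal_le_ofReal (min_le_min_left _ (Nat.cast_le.2 hij))
    · refine tendsto_const_nhds.congr' ?_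
      obtain ⟨K, hK⟩ := exists_nat_ge (V y)
      filter_upwards [eventually_ge_atTop K] with k hk
      rw [min_eq_left (hK.trans (Nat.cast_le.2 hk))]
    · rw [← ofReal_integral_eq_lintegral_ofReal _ (ae_of_all _ (hmin0 k))]
      · exact ENNReal.ofReal_le_ofReal (hint k x)
      · refine Integrable.of_bound (hmeas k).aestronglyMeasurable (k : ℝ) (ae_of_all _ fun y => ?_)
        rw [Real.norm_of_nonneg (hmin0 k y)]
        exact min_le_right _ _
  have hVi : ∀ x, Integrable V (Q x) := fun x =>
    ⟨hVm.aestronglyMeasurable, (hasFiniteIntegral_iff_ofReal (ae_of_all _ hV0)).2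
      ((hlint x).trans_lt ENNReal.ofReal_lt_top)⟩
  refine ⟨hVm, hV1, hVi, fun x => ?_⟩
  have h0 : 0 ≤ ((∫ x, V x ∂ν) + A) * V x := (integral_nonneg (hmin0 0)).trans (hint 0 x)
  rw [integral_eq_lintegral_of_nonneg_ae (ae_of_all _ hV0) hVm.aestronglyMeasurable]
  exact ENNReal.toReal_le_of_le_ofReal h0 (hlint x)

end Drift

section Chain

variable {E Ω β : Type*} [MeasurableSpace E] {𝓖 mΩ : MeasurableSpace Ω} [MeasurableSpace β]
  {P : Measure Ω} [IsProbabilityMeasure P]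

lemma map_prodMk_eq_compProd_of_condExp (h𝓖 : 𝓖 ≤ mΩ) {Y : Ω → β}
    (hY : Measurable[𝓖] Y) {Z : Ω → E} (hZ : Measurable Z) (κ : Kernel β E) [IsMarkovKernel κ]
    (hκ : ∀ B, MeasurableSet B →
      P[fun ω => B.indicator (fun _ => (1 : ℝ)) (Z ω)|𝓖] =ᵐ[P] fun ω => (κ (Y ω)).real B) :
    P.map (fun ω => (Y ω, Z ω)) = P.map Y ⊗ₘ κ := by
  have hYm : Measurable Y := hY.mono h𝓖 le_rfl
  have : IsProbabilityMeasure (P.map Y) := Measure.isProbabilityMeasure_map hYm.aemeasurable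
  have : IsProbabilityMeasure (P.map fun ω => (Y ω, Z ω)) :=
    Measure.isProbabilityMeasure_map (hYm.prodMk hZ).aemeasurable
  refine Measure.ext_prod fun {A B} hA hB => ?_
  rw [Measure.map_apply (hYm.prodMk hZ) (hA.prod hB), Measure.compProd_apply_prod hA hB,
    setLIntegral_map hA (κ.measurable_coe hB) hYm]
  have hG : MeasurableSet[𝓖] (Y ⁻¹' A) := hY hA
  have hf : (fun ω => B.indicator (fun _ => (1 : ℝ)) (Z ω)) =
      (Z ⁻¹' B).indicator (fun _ => (1 : ℝ)) := rfl
  have hfi : Integrable (fun ω => B.indicator (fun _ => (1 : ℝ)) (Z ω)) P := by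
    rw [hf]
    exact (integrable_const (1 : ℝ)).indicator (hZ hB)
  have h1 := setIntegral_condExp h𝓖 hfi hG
  rw [setIntegral_congr_ae (h𝓖 _ hG) ((hκ B hB).mono fun ω hω _ => hω), hf,
    setIntegral_indicator (hZ hB), setIntegral_const, smul_eq_mul, mul_one] at h1
  have hm : Measurable fun ω => κ (Y ω) B := (κ.measurable_coe hB).comp hYm
  simp only [measureReal_def] at h1
  rw [integral_toReal hm.aemeasurable (ae_of_all _ fun ω => measure_lt_top _ _)] at h1
  have hfin : ∫⁻ ω in Y ⁻¹' A, κ (Y ω) B ∂P ≠ ⊤ := by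
    refine ne_top_of_le_ne_top (measure_ne_top P (Y ⁻¹' A)) ?_
    refine (lintegral_mono fun ω => prob_le_one).trans_eq ?_
    simp
  rw [ENNReal.toReal_eq_toReal_iff' hfin (measure_ne_top _ _)] at h1
  exact h1.symm

variable {Q : Kernel E E} [IsMarkovKernel Q] {V : E → ℝ} {D : ℝ} {h : DriftBound Q V D}
  {ξ : E → ℝ} (hξ : Measurable ξ)

lemma DriftBound.integrable_comp_of_map_eq (h : DriftBound Q V D) {Y : Ω → ℝ × E}
    (hY : Measurable Y) {Z : Ω → E} (hZ : Measurable Z)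
    (hYZ : P.map (fun ω => (Y ω, Z ω)) = P.map Y ⊗ₘ Kernel.prodMkLeft ℝ Q)
    (hYV : Integrable (fun ω => V (Y ω).2) P) : Integrable (fun ω => V (Z ω)) P := by
  have : IsProbabilityMeasure (P.map Y) := Measure.isProbabilityMeasure_map hY.aemeasurable
  have hm : Measurable fun p : (ℝ × E) × E => V p.2 := h.measurable.comp measurable_snd
  have h1 : Integrable (fun p : (ℝ × E) × E => V p.2) (P.map Y ⊗ₘ Kernel.prodMkLeft ℝ Q) := by
    rw [Measure.integrable_compProd_iff hm.aestronglyMeasurable]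
    refine ⟨ae_of_all _ fun a => h.integrable a.2, ?_⟩
    have h2 : Integrable (fun a : ℝ × E => D * V a.2) (P.map Y) :=
      ((integrable_map_measure (h.measurable.comp measurable_snd).aestronglyMeasurable
        hY.aemeasurable).2 hYV).const_mul D
    refine h2.mono' ?_ (ae_of_all _ fun a => ?_)
    · exact (StronglyMeasurable.integral_kernel_prod_right
        (κ := Kernel.prodMkLeft ℝ Q) (f := fun a y => ‖V y‖)
        hm.norm.stronglyMeasurable).aestronglyMeasurable
    · simp only [Kernel.prodMkLeft_apply]
      rw [Real.norm_of_nonneg (integral_nonneg fun _ => norm_nonneg _)]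
      refine le_trans (le_of_eq (integral_congr_ae (ae_of_all _ fun y => ?_))) (h.integral_le a.2)
      exact Real.norm_of_nonneg (h.pos y).le
  rw [← hYZ, integrable_map_measure hm.aestronglyMeasurable (hY.prodMk hZ).aemeasurable] at h1
  exact h1

lemma DriftBound.integral_exp_mul_comp_of_map_eq (h : DriftBound Q V D) {Y : Ω → ℝ × E}
    (hY : Measurable Y) {Z : Ω → E} (hZ : Measurable Z)
    (hYZ : P.map (fun ω => (Y ω, Z ω)) = P.map Y ⊗ₘ Kernel.prodMkLeft ℝ Q)
    (hZV : Integrable (fun ω => V (Z ω)) P) (t : ℝ) (f : vBounded V) :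
    ∫ ω, Complex.exp (t * ((Y ω).1 + ξ (Z ω) : ℝ) * Complex.I) * f.1 (Z ω) ∂P =
      ∫ ω, Complex.exp (t * (Y ω).1 * Complex.I) * (twistedOp h hξ t f).1 (Y ω).2 ∂P := by
  have : IsProbabilityMeasure (P.map Y) := Measure.isProbabilityMeasure_map hY.aemeasurable
  obtain ⟨hf, M, hM⟩ := f.2
  let F : (ℝ × E) × E → ℂ := fun p =>
    Complex.exp (t * (p.1.1 + ξ p.2 : ℝ) * Complex.I) * f.1 p.2
  have hFm : Measurable F := by fun_prop
  have hFn : ∀ p, ‖F p‖ ≤ M * V p.2 := fun p => by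
    change ‖Complex.exp (t * (p.1.1 + ξ p.2 : ℝ) * Complex.I) * f.1 p.2‖ ≤ _
    rw [norm_mul, ← Complex.ofReal_mul, Complex.norm_exp_ofReal_mul_I, one_mul]
    exact hM _
  have hFi : Integrable F (P.map Y ⊗ₘ Kernel.prodMkLeft ℝ Q) := by
    rw [← hYZ, integrable_map_measure hFm.aestronglyMeasurable (hY.prodMk hZ).aemeasurable]
    exact (hZV.const_mul M).mono' (hFm.comp (hY.prodMk hZ)).aestronglyMeasurable
      (ae_of_all _ fun ω => hFn _)
  have h1 : ∫ ω, Complex.exp (t * ((Y ω).1 + ξ (Z ω) : ℝ) * Complex.I) * f.1 (Z ω) ∂P =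
      ∫ p, F p ∂(P.map fun ω => (Y ω, Z ω)) :=
    (integral_map (hY.prodMk hZ).aemeasurable hFm.aestronglyMeasurable).symm
  have h2 : ∀ a : ℝ × E, ∫ y, F (a, y) ∂(Kernel.prodMkLeft ℝ Q a) =
      Complex.exp (t * a.1 * Complex.I) * (twistedOp h hξ t f).1 a.2 := fun a => by
    change _ = _ * ∫ y, Complex.exp (t * ξ y * Complex.I) * f.1 y ∂(Q a.2)
    rw [← integral_const_mul, Kernel.prodMkLeft_apply]
    refine integral_congr_ae (ae_of_all _ fun y => ?_)
    change Complex.exp (t * (a.1 + ξ y : ℝ) * Complex.I) * f.1 y = _ * (_ * _)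
    rw [← mul_assoc, ← Complex.exp_add]
    push_cast
    ring_nf
  have hLm := (twistedOp h hξ t f).2.1
  rw [h1, hYZ, Measure.integral_compProd hFi]
  simp_rw [h2]
  rw [integral_map hY.aemeasurable]
  exact Measurable.aestronglyMeasurable (by fun_prop)

/-- The Fourier transform of the additive functional in terms of the twisted operator. -/
lemma DriftBound.integral_exp_mul_comp_eq (h : DriftBound Q V D) {X : ℕ → Ω → E}
    (hX : ∀ n, Measurable (X n)) {𝓕 : ℕ → MeasurableSpace Ω} (h𝓕 : ∀ n, 𝓕 n ≤ mΩ)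
    (hX𝓕 : ∀ n i, i ≤ n → Measurable[𝓕 n] (X i))
    (hM : ∀ n B, MeasurableSet B →
      P[fun ω => B.indicator (fun _ => (1 : ℝ)) (X (n + 1) ω)|𝓕 n] =ᵐ[P]
        fun ω => (Q (X n ω)).real B)
    {S : ℕ → Ω → ℝ} (hS : ∀ n ω, S n ω = ∑ k ∈ Finset.Icc 1 n, ξ (X k ω))
    (hV0 : Integrable (fun ω => V (X 0 ω)) P) (t : ℝ) (n : ℕ) :
    Integrable (fun ω => V (X n ω)) P ∧ ∀ f : vBounded V,
      ∫ ω, Complex.exp (t * S n ω * Complex.I) * f.1 (X n ω) ∂P =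
        ∫ ω, ((twistedOp h hξ t ^ n) f).1 (X 0 ω) ∂P := by
  induction n with
  | zero => exact ⟨hV0, fun f => by simp [hS]⟩
  | succ n ih =>
    have hY : Measurable[𝓕 n] fun ω => (S n ω, X n ω) := by
      refine Measurable.prodMk ?_ (hX𝓕 n n le_rfl)
      rw [show S n = fun ω => ∑ k ∈ Finset.Icc 1 n, ξ (X k ω) from funext (hS n)]
      exact Finset.measurable_sum _ fun k hk => hξ.comp (hX𝓕 n k (Finset.mem_Icc.1 hk).2)
    have hYm : Measurable fun ω => (S n ω, X n ω) := hY.mono (h𝓕 n) le_rfl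
    have hYZ := map_prodMk_eq_compProd_of_condExp (P := P) (h𝓕 n) hY (hX (n + 1))
      (Kernel.prodMkLeft ℝ Q) (hM n)
    have hVn := h.integrable_comp_of_map_eq hYm (hX (n + 1)) hYZ ih.1
    refine ⟨hVn, fun f => ?_⟩
    have h1 := h.integral_exp_mul_comp_of_map_eq hξ hYm (hX (n + 1)) hYZ hVn t f
    have h2 : ∀ ω, S (n + 1) ω = S n ω + ξ (X (n + 1) ω) := fun ω => by
      rw [hS, hS, Finset.sum_Icc_succ_top (by omega)]
    simp_rw [h2]
    rw [h1, ih.2, pow_succ, Module.End.mul_apply]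

end Chain

section Assembly

variable {E : Type*} [MeasurableSpace E] {Q : Kernel E E} [IsMarkovKernel Q] {V : E → ℝ}
  {ν : Measure E} [IsProbabilityMeasure ν]

lemma exists_geomErgodic (hVm : Measurable V) (hV1 : ∀ x, 1 ≤ V x) (hν : Integrable V ν)
    {QopC : (E → ℂ) → E → ℂ} (hQopC : ∀ f x, QopC f x = ∫ y, f y ∂(Q x))
    {C₀ κ₀ : ℝ} (hC₀ : 0 ≤ C₀) (hκ₀0 : 0 ≤ κ₀) (hκ₀1 : κ₀ < 1)
    (herg : ∀ n : ℕ, 1 ≤ n → ∀ f : E → ℂ, Measurable f → ∀ M : ℝ,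
      (∀ x, ‖f x‖ ≤ M * V x) →
      ∀ x, ‖QopC^[n] f x - ∫ y, f y ∂ν‖ ≤ C₀ * κ₀ ^ n * M * V x) :
    ∃ (D : ℝ) (h : DriftBound Q V D) (C θ : ℝ), 0 < θ ∧ θ < 1 ∧ GeomErgodic h hν C (θ ^ 3) := by
  have h : DriftBound Q V ((∫ x, V x ∂ν) + C₀ * κ₀) :=
    driftBound_of_norm_integral_sub_le hVm hV1 hν fun f hf hfV x => by
      simpa [hQopC] using herg 1 le_rfl f hf 1 (by simpa using hfV) x
  have hN := one_le_integral_weight h hν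
  set r := κ₀ ^ ((3 : ℕ) : ℝ)⁻¹ with hr
  have hr3 : r ^ 3 = κ₀ := Real.rpow_inv_natCast_pow hκ₀0 three_ne_zero
  have hr0 : 0 ≤ r := Real.rpow_nonneg hκ₀0 _
  have hr1 : r < 1 := Real.rpow_lt_one hκ₀0 hκ₀1 (by positivity)
  set θ := max r (1 / 2) with hθ
  have hθ0 : 0 < θ := lt_max_of_lt_right (by norm_num)
  have hθ1 : θ < 1 := max_lt hr1 (by norm_num)
  have hκθ : κ₀ ≤ θ ^ 3 := by
    rw [← hr3]
    exact pow_le_pow_left₀ hr0 (le_max_left _ _) 3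
  have hiter : ∀ (n : ℕ) (f : vBounded V), ((markovOp h ^ n) f).1 = QopC^[n] f.1 := by
    intro n f
    induction n with
    | zero => rfl
    | succ n ih =>
      rw [Function.iterate_succ_apply', ← ih, pow_succ', Module.End.mul_apply]
      ext x
      rw [hQopC]
      rfl
  refine ⟨_, h, C₀ + 1 + ∫ x, V x ∂ν, θ, hθ0, hθ1, by linarith, by positivity,
    pow_lt_one₀ hθ0.le hθ1 (by norm_num), fun n f M hM hf x => ?_⟩
  have hVx := (h.pos x).le
  rcases Nat.eq_zero_or_pos n with rfl | hn
  · have h1 := norm_meanOp_le hν hf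
    have h2 := hf x
    rw [pow_zero, pow_zero, Module.End.one_apply, mul_one]
    refine (norm_sub_le _ _).trans ((add_le_add h2 h1).trans ?_)
    have h3 : M * (∫ x, V x ∂ν) * 1 ≤ M * (∫ x, V x ∂ν) * V x :=
      mul_le_mul_of_nonneg_left (h.one_le x) (by positivity)
    have h4 : 0 ≤ C₀ * M * V x := by positivity
    linarith
  · rw [hiter]
    refine (herg n hn f.1 f.2.1 M hf x).trans ?_
    gcongr
    linarith

lemma exists_norm_twistedOp_pow_one_sub_le {D : ℝ} {h : DriftBound Q V D} {hν : Integrable V ν}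
    {C θ : ℝ} (hθ0 : 0 < θ) (hθ1 : θ < 1) (H : GeomErgodic h hν C (θ ^ 3))
    {Qop : (E → ℝ) → E → ℝ} (hQop : ∀ f x, Qop f x = ∫ y, f y ∂(Q x))
    {ξ : E → ℝ} (hξ : Measurable ξ) (hξν : ∫ x, ξ x ∂ν = 0)
    {c : ℝ} (hc : 0 < c) (hdom : ∀ x, |ξ x| ^ 3 ≤ c * V x) {ξc : E → ℝ}
    (hξc : ∀ ε > (0 : ℝ), ∃ N₀ : ℕ, ∀ N, N₀ ≤ N → ∀ x,
      |(∑ n ∈ Finset.range N, Qop^[n] ξ x) - ξc x| ≤ ε * V x ^ ((1 : ℝ) / 3))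
    {σ2 : ℝ} (hσ2 : σ2 = (∫ x, ξc x ^ 2 ∂ν) - ∫ x, Qop ξc x ^ 2 ∂ν) (hσpos : 0 < σ2) :
    ∃ α B c₂ : ℝ, 0 < α ∧ 0 ≤ B ∧ 0 < c₂ ∧ ∀ t : ℝ, |t| ≤ α → ∀ (n : ℕ) x,
      ‖((twistedOp h hξ t ^ n) h.one).1 x - (Real.exp (-(n * (σ2 * t ^ 2 / 2))) : ℝ)‖ ≤
        B * |t| * Real.exp (-c₂ * n * t ^ 2) * V x := by
  have hV0 : ∀ x, 0 ≤ V x := fun x => (h.pos x).le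
  set U : E → ℝ := fun x => V x ^ ((1 : ℝ) / 3) with hUdef
  have hU : Measurable U := h.measurable.pow_const _
  have hU1 : ∀ x, 1 ≤ U x := fun x => Real.one_le_rpow (h.one_le x) (by norm_num)
  have hU0 : ∀ x, 0 < U x := fun x => zero_lt_one.trans_le (hU1 x)
  have hUV : ∀ x, U x ^ 3 = V x := fun x => by
    have := Real.rpow_inv_natCast_pow (hV0 x) three_ne_zero
    simpa [hUdef] using this
  have hUV' : ∀ x, U x ≤ V x := fun x => by
    rw [← hUV]
    exact le_self_pow₀ (hU1 x) three_ne_zero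
  have hU2V : ∀ x, U x ^ 2 ≤ V x := fun x => by
    rw [← hUV]
    exact pow_le_pow_right₀ (hU1 x) (by omega)
  set b := c ^ ((3 : ℕ) : ℝ)⁻¹ with hbdef
  have hb3 : b ^ 3 = c := Real.rpow_inv_natCast_pow hc.le three_ne_zero
  have hb0 : 0 ≤ b := Real.rpow_nonneg hc.le _
  have hb : ∀ x, |ξ x| ≤ b * U x := fun x => by
    refine le_of_pow_le_pow_left₀ three_ne_zero (mul_nonneg hb0 (hU0 x).le) ?_
    rw [mul_pow, hb3, hUV]
    exact hdom x
  have hbV : ∀ x, |ξ x| ≤ b * V x := fun x =>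
    (hb x).trans (mul_le_mul_of_nonneg_left (hUV' x) hb0)
  let X : vBounded V := ⟨fun x => (ξ x : ℂ), Complex.measurable_ofReal.comp hξ, b, fun x => by
    rw [Complex.norm_real]
    exact hbV x⟩
  have hXb : ∀ x, ‖X.1 x‖ ≤ b * U x ^ 1 := fun x => by
    change ‖(ξ x : ℂ)‖ ≤ _
    rw [Complex.norm_real, pow_one]
    exact hb x
  have hX0 : meanOp hν X = 0 := by
    change ∫ x, (ξ x : ℂ) ∂ν = 0
    rw [integral_complex_ofReal, hξν, Complex.ofReal_zero]
  obtain ⟨G, M, hM, hGM, hG, hG0, hGlim⟩ :=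
    H.exists_poisson hθ0 hθ1 hU hU1 hUV (p := 1) (q := 2) le_rfl (by norm_num) hb0 hXb hX0
  simp_rw [pow_one] at hGM
  have hiter : ∀ (n : ℕ) x, ((markovOp h ^ n) X).1 x = (Qop^[n] ξ x : ℂ) := by
    intro n
    induction n with
    | zero => exact fun x => rfl
    | succ n ih =>
      intro x
      rw [Function.iterate_succ_apply', pow_succ', Module.End.mul_apply, hQop,
        ← integral_complex_ofReal]
      exact integral_congr_ae (ae_of_all _ ih)
  have hGξ : ∀ x, G.1 x = ξc x := by
    intro x
    have h1 : Tendsto (fun N => ∑ n ∈ Finset.range N, Qop^[n] ξ x) atTop (nhds (ξc x)) := by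
      refine Metric.tendsto_atTop.2 fun ε hε => ?_
      obtain ⟨N₀, hN₀⟩ := hξc (ε / 2 / U x) (div_pos (half_pos hε) (hU0 x))
      refine ⟨N₀, fun N hN => ?_⟩
      rw [Real.dist_eq]
      refine (hN₀ N hN x).trans_lt ?_
      rw [← hUdef] at *
      change ε / 2 / U x * U x < ε
      rw [div_mul_cancel₀ _ (hU0 x).ne']
      exact half_lt_self hε
    have h2 := (Complex.continuous_ofReal.tendsto _).comp h1
    refine tendsto_nhds_unique (hGlim x) (h2.congr fun N => ?_)
    rw [Function.comp_apply, AddSubmonoidClass.coe_finsetSum, Finset.sum_apply,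
      Complex.ofReal_sum]
    exact Finset.sum_congr rfl fun n _ => (hiter n x).symm
  have hPG : ∀ x, (markovOp h G).1 x = Qop ξc x := fun x => by
    rw [hQop, ← integral_complex_ofReal]
    exact integral_congr_ae (ae_of_all _ hGξ)
  have hG' : ∀ x, G.1 x = ξ x + (markovOp h G).1 x :=
    fun x => congrArg (fun f : vBounded V => f.1 x) hG
  have hsq : ∀ {φ : E → ℝ} {M : ℝ}, Measurable φ → (∀ x, |φ x| ≤ M * U x) →
      Integrable (fun x => φ x ^ 2) ν := fun {φ M} hφ hφM => by
    refine (hν.const_mul (M ^ 2)).mono' (hφ.pow_const 2).aestronglyMeasurable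
      (ae_of_all _ fun x => ?_)
    rw [Real.norm_eq_abs, abs_pow]
    refine (pow_le_pow_left₀ (abs_nonneg _) (hφM x) 2).trans ?_
    rw [mul_pow]
    exact mul_le_mul_of_nonneg_left (hU2V x) (sq_nonneg M)
  have hξcm : Measurable ξc := by
    have : ξc = fun x => (G.1 x).re := funext fun x => by rw [hGξ, Complex.ofReal_re]
    rw [this]
    exact Complex.measurable_re.comp G.2.1
  have hQξcm : Measurable (Qop ξc) := by
    have : Qop ξc = fun x => ((markovOp h G).1 x).re :=
      funext fun x => by rw [hPG, Complex.ofReal_re]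
    rw [this]
    exact Complex.measurable_re.comp (markovOp h G).2.1
  have hξcM : ∀ x, |ξc x| ≤ M * U x := fun x => by
    have := hGM x
    rwa [hGξ, Complex.norm_real] at this
  have hQξcM : ∀ x, |Qop ξc x| ≤ (M + b) * U x := fun x => by
    have h1 : Qop ξc x = ξc x - ξ x := by
      have := hG' x
      rw [hGξ, hPG] at this
      have : ξc x = ξ x + Qop ξc x := by exact_mod_cast this
      linarith
    rw [h1, add_mul]
    exact (abs_sub _ _).trans (add_le_add (hξcM x) (hb x))
  have hs : ∫ x, (G.1 x ^ 2 - (markovOp h G).1 x ^ 2) ∂ν = σ2 := by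
    rw [hσ2, ← integral_sub (hsq hξcm hξcM) (hsq hQξcm hQξcM), ← integral_complex_ofReal]
    refine integral_congr_ae (ae_of_all _ fun x => ?_)
    simp only [hGξ, hPG]
    push_cast
    rfl
  obtain ⟨g, k, K, hK, hgK, hkK, hg0, hk0, hφ⟩ :=
    H.exists_approxEigenfunction hξ hθ0 hθ1 hU hU1 hUV hb hM hGM hG0 hG' hs
  exact H.exists_norm_twistedOp_pow_one_sub_le hξ hbV hσpos hK hgK hkK hg0 hk0 hφ

end Assembly

section BerryEsseen

/-- A Berry-Esseen bound from a Gaussian approximation of the unnormalised characteristic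
functions at low frequencies. -/
lemma exists_berry_esseen_of_charFun {Ω : Type*} [MeasurableSpace Ω] {P : Measure Ω}
    [IsProbabilityMeasure P] {S : ℕ → Ω → ℝ} (hS : ∀ n, Measurable (S n)) {σ2 α B c : ℝ}
    (hσ : 0 < σ2) (hα : 0 < α) (hB : 0 ≤ B) (hc : 0 < c)
    (hchar : ∀ t : ℝ, |t| ≤ α → ∀ n : ℕ,
      ‖∫ ω, Complex.exp (t * S n ω * Complex.I) ∂P - (Real.exp (-(n * (σ2 * t ^ 2 / 2))) : ℝ)‖ ≤
        B * |t| * Real.exp (-c * n * t ^ 2)) :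
    ∃ C > (0 : ℝ), ∀ n : ℕ, 1 ≤ n → ∀ x : ℝ,
      |(P {ω | S n ω / (Real.sqrt σ2 * Real.sqrt n) ≤ x}).toReal
          - ((gaussianReal 0 1) (Set.Iic x)).toReal| ≤ C / Real.sqrt n := by
  obtain ⟨A, hA, hE⟩ := exists_esseen_gaussian (c / σ2) (by positivity)
  have hσ0 : 0 < Real.sqrt σ2 := Real.sqrt_pos.2 hσ
  refine ⟨A * (1 / (α * Real.sqrt σ2) + B / Real.sqrt σ2), by positivity, fun n hn x => ?_⟩
  have hn0 : (0 : ℝ) < n := by exact_mod_cast hn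
  have hsn : 0 < Real.sqrt n := Real.sqrt_pos.2 hn0
  set r := Real.sqrt σ2 * Real.sqrt n with hr
  have hr0 : 0 < r := mul_pos hσ0 hsn
  have hr2 : r ^ 2 = σ2 * n := by
    rw [hr, mul_pow, Real.sq_sqrt hσ.le, Real.sq_sqrt hn0.le]
  have hm : Measurable fun ω => S n ω / r := (hS n).div_const r
  have : IsProbabilityMeasure (P.map fun ω => S n ω / r) :=
    Measure.isProbabilityMeasure_map hm.aemeasurable
  have h1 := hE (P.map fun ω => S n ω / r) (α * r) (B / r) (by positivity)
    (fun t ht => by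
      have ht' : |t / r| ≤ α := by
        rw [abs_of_pos (div_pos ht.1 hr0), div_le_iff₀ hr0]
        exact ht.2
      have h2 := hchar (t / r) ht' n
      rw [charFun_apply_real, integral_map hm.aemeasurable
        (Measurable.aestronglyMeasurable (by fun_prop))]
      have e1 : ∀ ω, Complex.exp (t * (S n ω / r : ℝ) * Complex.I) =
          Complex.exp ((t / r : ℝ) * S n ω * Complex.I) := fun ω => by
        push_cast
        ring_nf
      have e2 : (n : ℝ) * (σ2 * (t / r) ^ 2 / 2) = t ^ 2 / 2 := by
        rw [div_pow, hr2]
        field_simp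
      have e3 : -c * n * (t / r) ^ 2 = -(c / σ2) * t ^ 2 := by
        rw [div_pow, hr2]
        field_simp
      rw [e2, e3, abs_of_pos (div_pos ht.1 hr0)] at h2
      simp_rw [e1]
      have e4 : Complex.exp (-(t ^ 2 / 2)) = (Real.exp (-(t ^ 2 / 2)) : ℝ) := by
        push_cast
        rfl
      rw [e4]
      refine h2.trans_eq ?_
      ring) x
  rw [map_measureReal_apply hm measurableSet_Iic] at h1
  refine h1.trans_eq ?_
  rw [hr]
  field_simp

end BerryEsseen

/-- Corollary 3.1 of the paper: for a `V`-geometrically ergodic, aperiodic and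
`ψ`-irreducible Markov chain, if `|ξ|³ ≤ c V`, `σ² > 0` and `𝔼[V(X₀)] < ∞`, then the
central limit theorem holds with rate `n^{−1/2}`. -/
theorem stmt_8
    {E : Type*} [MetricSpace E] [MeasurableSpace E] [BorelSpace E]
    [MeasurableSpace.CountablyGenerated E]
    (hballs : ∀ (x : E) (r : ℝ), IsCompact (Metric.closedBall x r))
    (hunbounded : ¬ Bornology.IsBounded (Set.univ : Set E))
    (x₀ : E)
    -- the function `V : E → [1,∞)`, tending to `∞` at infinity
    (V : E → ℝ) (hVmeas : Measurable V) (hV1 : ∀ x, 1 ≤ V x)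
    (hVinfty : Tendsto V (comap (fun x => dist x x₀) atTop) atTop)
    -- the transition kernel, its action on functions, and its iterates as measures
    (Q : Kernel E E) [IsMarkovKernel Q]
    (Qop : (E → ℝ) → E → ℝ) (hQop : ∀ f x, Qop f x = ∫ y, f y ∂(Q x))
    (QopC : (E → ℂ) → E → ℂ) (hQopC : ∀ f x, QopC f x = ∫ y, f y ∂(Q x))
    (Qiter : ℕ → E → Measure E)
    (hQiter0 : ∀ x, Qiter 0 x = Measure.dirac x)
    (hQiterS : ∀ n x, Qiter (n + 1) x = (Qiter n x).bind (fun y => Q y))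
    -- the invariant probability measure with `ν(V) < ∞`
    (ν : Measure E) [IsProbabilityMeasure ν]
    (hinv : ν.bind (fun x => Q x) = ν) (hνV : Integrable V ν)
    -- `V`-geometric ergodicity: `‖Q^n f − ν(f)𝟏‖_V ≤ C₀ κ₀^n ‖f‖_V`
    (C₀ κ₀ : ℝ) (hC₀ : 0 ≤ C₀) (hκ₀0 : 0 ≤ κ₀) (hκ₀1 : κ₀ < 1)
    (herg : ∀ n : ℕ, 1 ≤ n → ∀ f : E → ℂ, Measurable f → ∀ M : ℝ,
      (∀ x, ‖f x‖ ≤ M * V x) →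
      ∀ x, ‖QopC^[n] f x - ∫ y, f y ∂ν‖ ≤ C₀ * κ₀ ^ n * M * V x)
    -- aperiodicity and `ψ`-irreducibility (Meyn–Tweedie)
    (ψm : Measure E) [SigmaFinite ψm] (hψm : ψm ≠ 0)
    (hirr : ∀ A : Set E, MeasurableSet A → ψm A ≠ 0 → ∀ x, ∃ n, 1 ≤ n ∧ Qiter n x A ≠ 0)
    (haper : ∀ A : Set E, MeasurableSet A → ψm A ≠ 0 → ∀ x, ∃ N, ∀ n, N ≤ n →
      Qiter n x A ≠ 0)
    -- the Markov chain with kernel `Q`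
    {Ω : Type*} [MeasurableSpace Ω] (P : Measure Ω) [IsProbabilityMeasure P]
    (X : ℕ → Ω → E) (hXmeas : ∀ n, Measurable (X n))
    (𝓕 : ℕ → MeasurableSpace Ω)
    (h𝓕 : ∀ n, 𝓕 n = ⨆ i ∈ Finset.range (n + 1), MeasurableSpace.comap (X i) inferInstance)
    (hMarkov : ∀ n, ∀ f : E → ℝ, Measurable f → (∃ M, ∀ x, |f x| ≤ M) →
      P[(fun ω => f (X (n + 1) ω)) | 𝓕 n] =ᵐ[P] fun ω => Qop f (X n ω))
    -- the function `ξ`, with `ν(ξ) = 0` and `|ξ|³ ≤ c V`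
    (ξ : E → ℝ) (hξmeas : Measurable ξ) (hξν : ∫ x, ξ x ∂ν = 0)
    (c : ℝ) (hc : 0 < c) (hdom : ∀ x, |ξ x| ^ 3 ≤ c * V x)
    -- `ξ̌ = Σ_{n≥0} Q^n ξ`, converging in `B_{V^{1/3}}`, and `σ²`
    (ξc : E → ℝ)
    (hξc : ∀ ε > (0 : ℝ), ∃ N₀ : ℕ, ∀ N, N₀ ≤ N → ∀ x,
      |(∑ n ∈ Finset.range N, Qop^[n] ξ x) - ξc x| ≤ ε * V x ^ ((1 : ℝ) / 3))
    (σ2 : ℝ) (hσ2 : σ2 = (∫ x, ξc x ^ 2 ∂ν) - ∫ x, Qop ξc x ^ 2 ∂ν)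
    -- `S_n = Σ_{k=1}^n ξ(X_k)`
    (S : ℕ → Ω → ℝ) (hS : ∀ n ω, S n ω = ∑ k ∈ Finset.Icc 1 n, ξ (X k ω))
    -- the hypotheses of the corollary
    (hσpos : 0 < σ2) (hVX0 : Integrable (fun ω => V (X 0 ω)) P) :
    ∃ C > (0 : ℝ), ∀ n : ℕ, 1 ≤ n → ∀ x : ℝ,
      |(P {ω | S n ω / (Real.sqrt σ2 * Real.sqrt n) ≤ x}).toReal
          - ((gaussianReal 0 1) (Set.Iic x)).toReal| ≤ C / Real.sqrt n := by
  have : Nonempty E := ⟨x₀⟩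
  obtain ⟨D, h, C, θ, hθ0, hθ1, H⟩ :=
    exists_geomErgodic hVmeas hV1 hνV hQopC hC₀ hκ₀0 hκ₀1 herg
  obtain ⟨α, B, c₂, hα, hB, hc₂, hbound⟩ :=
    exists_norm_twistedOp_pow_one_sub_le hθ0 hθ1 H hQop hξmeas hξν hc hdom hξc hσ2 hσpos
  have hSm : ∀ n, Measurable (S n) := fun n => by
    rw [show S n = fun ω => ∑ k ∈ Finset.Icc 1 n, ξ (X k ω) from funext (hS n)]
    exact Finset.measurable_sum _ fun k _ => hξmeas.comp (hXmeas k)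
  have h𝓕le : ∀ n, 𝓕 n ≤ ‹MeasurableSpace Ω› := fun n => by
    rw [h𝓕]
    exact iSup₂_le fun i _ => (hXmeas i).comap_le
  have hX𝓕 : ∀ n i, i ≤ n → Measurable[𝓕 n] (X i) := fun n i hi => by
    rw [h𝓕]
    exact (comap_measurable (X i)).mono
      (le_iSup₂ (f := fun i (_ : i ∈ Finset.range (n + 1)) =>
        MeasurableSpace.comap (X i) inferInstance) i (Finset.mem_range.2 (by omega))) le_rfl
  have hM : ∀ n A, MeasurableSet A →
      P[fun ω => A.indicator (fun _ => (1 : ℝ)) (X (n + 1) ω)|𝓕 n] =ᵐ[P]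
        fun ω => (Q (X n ω)).real A := fun n A hA => by
    have hA' := hMarkov n (A.indicator fun _ => (1 : ℝ)) (measurable_const.indicator hA)
      ⟨1, fun x => by by_cases hx : x ∈ A <;> simp [hx]⟩
    simpa [hQop, integral_indicator_const, hA] using hA'
  have hVX0' : 0 ≤ ∫ ω, V (X 0 ω) ∂P := integral_nonneg fun ω => (h.pos _).le
  refine exists_berry_esseen_of_charFun hSm hσpos hα (mul_nonneg hB hVX0') hc₂ fun t ht n => ?_
  have hint := (h.integral_exp_mul_comp_eq hξmeas hXmeas h𝓕le hX𝓕 hM hS hVX0 t n).2 h.one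
  rw [show (∫ ω, Complex.exp (t * S n ω * Complex.I) ∂P) =
      ∫ ω, ((twistedOp h hξmeas t ^ n) h.one).1 (X 0 ω) ∂P by
    rw [← hint]; simp [DriftBound.one]]
  set f := (twistedOp h hξmeas t ^ n) h.one with hf
  obtain ⟨M, -, hfM⟩ := exists_bound_of_vBounded hV1 f
  have hfi : Integrable (fun ω => f.1 (X 0 ω)) P :=
    (hVX0.const_mul M).mono' (f.2.1.comp (hXmeas 0)).aestronglyMeasurable
      (ae_of_all _ fun ω => hfM _)
  have hsub := integral_sub hfi
    (integrable_const (μ := P) ((Real.exp (-(n * (σ2 * t ^ 2 / 2))) : ℝ) : ℂ))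
  rw [integral_const, probReal_univ, one_smul] at hsub
  rw [← hsub]
  refine (norm_integral_le_of_norm_le (hVX0.const_mul _)
    (ae_of_all _ fun ω => hbound t ht n (X 0 ω))).trans_eq ?_
  rw [integral_const_mul]
  ring
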